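/- arXiv:2204.07814 — 2 statements merged into one kernel-verified Lean document; each statement's English description precedes it below -/
import Mathlib

section
/- Let Ω := {1,…,m}^ℤ carry the Bernoulli product measure 𝐏 := (p_1,…,p_m)^{⊗ℤ} for a probability vector with all p_i > 0, let σ be the left shift and d_θ the symbolic metric for some θ ∈ (0,1). Let m denote Lebesgue measure on [0,1], and let (ν^ω)_{ω∈Ω} be Borel probability measures on [0,1] with densities h_ω := dν^ω/dm satisfying C^{−1} ≤ h_ω ≤ C m-a.e. for some C > 0 and 𝐏-a.e. ω, and such that ω ↦ h_ω ∈ L^∞(m) is Hölder continuous with respect to d_θ; set ν(A) := ∫_Ω ν^ω(A) d𝐏(ω). If (A_n)_{n≥1} are measurable subsets of [0,1] with m(A_n) ≤ K/n for some K > 0, then for 𝐏-a.e. ω ∈ Ω and all 0 ≤ s < t: lim_{n→∞} [ Σ_{j=⌊ns⌋+1}^{⌊nt⌋} ν^{σ^j ω}(A_n) − n(t−s) ν(A_n) ] = 0. -/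
open MeasureTheory Filter Set Topology

noncomputable section

/-- The two-sided shift space on `m` symbols. -/
abbrev Om (m : ℕ) := ℤ → Fin m

/-- The left shift on the two-sided shift space. -/
def shift {m : ℕ} (ω : Om m) : Om m := fun i => ω (i + 1)

/-- Lebesgue measure on `[0,1]`. -/
def mLeb : Measure ℝ := volume.restrict (Set.Icc 0 1)

lemma shift_iter {m : ℕ} (j : ℕ) (ω : Om m) (i : ℤ) : (shift^[j] ω) i = ω (i + j) := by
  induction j generalizing ω i with
  | zero => simp
  | succ j ih =>
    rw [Function.iterate_succ_apply, ih]
    simp only [shift]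
    congr 1
    push_cast
    ring

lemma indicator_slln {Ω : Type*} [MeasurableSpace Ω] (P : Measure Ω) [IsProbabilityMeasure P]
    (E : ℕ → Set Ω) (hE : ∀ i, MeasurableSet (E i)) (hident : ∀ i, P (E i) = P (E 0))
    (hindep : ∀ i j, i < j → P (E i ∩ E j) = P (E i) * P (E j)) :
    ∀ᵐ ω ∂P, Tendsto (fun n : ℕ => (∑ i ∈ Finset.range n, (E i).indicator (fun _ => (1 : ℝ)) ω) / n)
      atTop (𝓝 (P.real (E 0))) := by
  have hm : ∀ i, Measurable ((E i).indicator (fun _ => (1 : ℝ))) := fun i =>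
    measurable_const.indicator (hE i)
  have key := ProbabilityTheory.strong_law_ae_real (μ := P)
    (fun i => (E i).indicator (fun _ => (1 : ℝ)))
    ((integrable_const (1 : ℝ)).indicator (hE 0)) ?_ ?_
  · have h0 : ∫ a, (E 0).indicator (fun _ => (1 : ℝ)) a ∂P = P.real (E 0) := by
      rw [integral_indicator (hE 0)]; simp
    rw [h0] at key
    exact key
  · intro i j hij
    have h1 : ∀ i, MeasurableSpace.comap ((E i).indicator (fun _ => (1 : ℝ))) inferInstance
        ≤ MeasurableSpace.generateFrom {E i} := by
      intro i
      rw [← measurable_iff_comap_le]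
      exact measurable_const.indicator (MeasurableSpace.measurableSet_generateFrom rfl)
    have h2 : ProbabilityTheory.IndepSet (E i) (E j) P := by
      rw [ProbabilityTheory.indepSet_iff_measure_inter_eq_mul (hE i) (hE j) (μ := P)]
      rcases lt_or_gt_of_ne hij with h | h
      · exact hindep i j h
      · rw [inter_comm, hindep j i h, mul_comm]
    rw [ProbabilityTheory.IndepSet_iff_Indep] at h2
    exact ProbabilityTheory.indep_of_indep_of_le_left
      (ProbabilityTheory.indep_of_indep_of_le_right h2 (h1 j)) (h1 i)
  · intro i
    refine ⟨(hm i).aemeasurable, (hm 0).aemeasurable, ?_⟩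
    ext S hS
    rw [Measure.map_apply (hm i) hS, Measure.map_apply (hm 0) hS]
    classical
    simp only [Set.indicator_const_preimage_eq_union]
    by_cases h1 : (1 : ℝ) ∈ S <;> by_cases h0 : (0 : ℝ) ∈ S
    · simp [h1, h0]
    · simp [h1, h0, hident i]
    · simp [h1, h0, prob_compl_eq_one_sub (hE _), hident i]
    · simp [h1, h0]

lemma sum_blocks (f : ℕ → ℝ) (L n : ℕ) :
    ∑ j ∈ Finset.range (n * L), f j
      = ∑ r ∈ Finset.range L, ∑ i ∈ Finset.range n, f (i * L + r) := by
  induction n with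
  | zero => simp
  | succ n ih =>
    rw [Nat.succ_mul, Finset.sum_range_add, ih, ← Finset.sum_add_distrib]
    exact Finset.sum_congr rfl fun r _ => by rw [Finset.sum_range_succ]

lemma cesaro_of_residues (f : ℕ → ℝ) (hf0 : ∀ j, 0 ≤ f j) (hf1 : ∀ j, f j ≤ 1) (L : ℕ)
    (hL : 0 < L) (c : ℝ)
    (h : ∀ r < L, Tendsto (fun n : ℕ => (∑ i ∈ Finset.range n, f (i * L + r)) / n)
      atTop (𝓝 c)) :
    Tendsto (fun n : ℕ => (∑ i ∈ Finset.range n, f i) / n) atTop (𝓝 c) := by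
  have hL' : (0 : ℝ) < L := by exact_mod_cast hL
  -- along multiples of L
  have h1 : Tendsto (fun n : ℕ => (∑ j ∈ Finset.range (n * L), f j) / n) atTop (𝓝 (L * c)) := by
    have := tendsto_finsetSum (Finset.range L) (fun r hr => h r (Finset.mem_range.1 hr))
    simp only [Finset.sum_const, Finset.card_range, nsmul_eq_mul] at this
    refine this.congr fun n => ?_
    rw [sum_blocks, Finset.sum_div]
  have hdiv : Tendsto (fun N : ℕ => N / L) atTop atTop := Nat.tendsto_div_const_atTop hL.ne'
  have h2 := h1.comp hdiv
  have h3 : Tendsto (fun N : ℕ => ((N / L : ℕ) : ℝ) / N) atTop (𝓝 (L : ℝ)⁻¹) := by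
    have h4 := (tendsto_nat_floor_mul_div_atTop (R := ℝ) (a := (L : ℝ)⁻¹)
      (by positivity)).comp tendsto_natCast_atTop_atTop
    refine h4.congr fun N => ?_
    simp only [Function.comp]
    congr 2
    rw [inv_mul_eq_div, Nat.floor_div_natCast, Nat.floor_natCast]
  have h5 := h2.mul h3
  have h6 : (L : ℝ) * c * (L : ℝ)⁻¹ = c := by field_simp
  rw [h6] at h5
  have h7 : Tendsto (fun N : ℕ => (L : ℝ) / N) atTop (𝓝 0) :=
    tendsto_const_div_atTop_nhds_zero_nat _
  have h8 : Tendsto (fun N : ℕ => (∑ i ∈ Finset.range N, f i) / N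
      - ((fun n : ℕ => (∑ j ∈ Finset.range (n * L), f j) / n) ∘ fun N => N / L) N
        * (((N / L : ℕ) : ℝ) / N)) atTop (𝓝 0) := by
    refine squeeze_zero_norm' ?_ h7
    filter_upwards [eventually_ge_atTop L] with N hN
    have hq : 0 < N / L := Nat.div_pos hN hL
    have hq' : (0 : ℝ) < ((N / L : ℕ) : ℝ) := by exact_mod_cast hq
    have hNp : (0 : ℝ) < N := by exact_mod_cast lt_of_lt_of_le hL hN
    have hsplit : ∑ i ∈ Finset.range N, f i = ∑ i ∈ Finset.range (N / L * L), f i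
        + ∑ i ∈ Finset.range (N % L), f (N / L * L + i) := by
      rw [← Finset.sum_range_add, Nat.div_add_mod']
    simp only [Function.comp]
    rw [div_mul_div_cancel₀ hq'.ne', ← sub_div, hsplit, add_sub_cancel_left, norm_div,
      Real.norm_natCast, Real.norm_of_nonneg (Finset.sum_nonneg fun i _ => hf0 _)]
    gcongr
    calc ∑ i ∈ Finset.range (N % L), f (N / L * L + i) ≤ ∑ i ∈ Finset.range (N % L), (1 : ℝ) :=
          Finset.sum_le_sum fun i _ => hf1 _
      _ = ((N % L : ℕ) : ℝ) := by simp
      _ ≤ L := by exact_mod_cast (Nat.mod_lt _ hL).le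
  have h9 := h8.add h5
  simp only [zero_add] at h9
  refine h9.congr fun N => ?_
  ring

lemma cyl_slln (m : ℕ)
    (p : Fin m → ℝ) (hp : ∀ i, 0 < p i)
    (P : Measure (Om m)) [IsProbabilityMeasure P]
    (hP : ∀ (s : Finset ℤ) (f : ℤ → Fin m),
      P {ω | ∀ i ∈ s, ω i = f i} = ENNReal.ofReal (∏ i ∈ s, p (f i)))
    (k : ℕ) (f : Om m) :
    ∀ᵐ ω ∂P, Tendsto (fun n : ℕ => (∑ j ∈ Finset.range n,
        {ω : Om m | ∀ i ∈ Finset.Icc (-(k : ℤ)) k, ω i = f i}.indicator (fun _ => (1 : ℝ))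
          (shift^[j + 1] ω)) / n)
      atTop (𝓝 (P.real {ω : Om m | ∀ i ∈ Finset.Icc (-(k : ℤ)) k, ω i = f i})) := by
  set s := Finset.Icc (-(k : ℤ)) k with hs
  set E : ℕ → Set (Om m) := fun j => {ω | ∀ i ∈ s.map (addRightEmbedding (j : ℤ)), ω i = f (i - j)}
    with hE
  have hEm : ∀ j, MeasurableSet (E j) := by
    intro j
    have : E j = ⋂ i ∈ s.map (addRightEmbedding (j : ℤ)), (fun ω : Om m => ω i) ⁻¹' {f (i - j)} := by
      ext ω; simp [hE]
    rw [this]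
    exact Finset.measurableSet_biInter _ fun i _ =>
      measurable_pi_apply i (measurableSet_singleton _)
  have hPE : ∀ j, P (E j) = ENNReal.ofReal (∏ i ∈ s, p (f i)) := by
    intro j
    rw [hE]
    rw [hP (s.map (addRightEmbedding (j : ℤ))) (fun i => f (i - j)), Finset.prod_map]
    simp
  have hP0 : P {ω : Om m | ∀ i ∈ s, ω i = f i} = ENNReal.ofReal (∏ i ∈ s, p (f i)) := hP s f
  have hreal : ∀ j, P.real (E j) = P.real {ω : Om m | ∀ i ∈ s, ω i = f i} := by
    intro j
    rw [measureReal_def, measureReal_def, hPE, hP0]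
  have hind : ∀ j j' : ℕ, j + (2 * k + 1) ≤ j' → P (E j ∩ E j') = P (E j) * P (E j') := by
    intro j j' hjj
    have hdisj : Disjoint (s.map (addRightEmbedding (j : ℤ))) (s.map (addRightEmbedding (j' : ℤ))) := by
      rw [Finset.disjoint_left]
      intro i hi hi'
      simp only [Finset.mem_map, hs, Finset.mem_Icc, addRightEmbedding_apply] at hi hi'
      obtain ⟨a, ha, rfl⟩ := hi
      obtain ⟨b, hb, hab⟩ := hi'
      omega
    classical
    set g : ℤ → Fin m := fun i => if i ∈ s.map (addRightEmbedding (j : ℤ)) then f (i - j)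
      else f (i - j') with hg
    have hg1 : ∀ i ∈ s.map (addRightEmbedding (j : ℤ)), g i = f (i - j) := by
      intro i hi; simp only [hg]; rw [if_pos hi]
    have hg2 : ∀ i ∈ s.map (addRightEmbedding (j' : ℤ)), g i = f (i - j') := by
      intro i hi; simp only [hg]; rw [if_neg (Finset.disjoint_right.1 hdisj hi)]
    have hEE : E j ∩ E j' = {ω | ∀ i ∈ s.map (addRightEmbedding (j : ℤ)) ∪
        s.map (addRightEmbedding (j' : ℤ)), ω i = g i} := by
      ext ω
      simp only [hE, mem_inter_iff, mem_ofPred_eq, Finset.mem_union]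
      constructor
      · rintro ⟨h1, h2⟩ i (hi | hi)
        · rw [h1 i hi, hg1 i hi]
        · rw [h2 i hi, hg2 i hi]
      · intro h
        exact ⟨fun i hi => by rw [h i (Or.inl hi), hg1 i hi],
          fun i hi => by rw [h i (Or.inr hi), hg2 i hi]⟩
    have e1 : ∏ i ∈ s.map (addRightEmbedding (j : ℤ)), p (g i) = ∏ i ∈ s, p (f i) := by
      rw [Finset.prod_congr rfl fun i hi => by rw [hg1 i hi], Finset.prod_map]
      simp
    have e2 : ∏ i ∈ s.map (addRightEmbedding (j' : ℤ)), p (g i) = ∏ i ∈ s, p (f i) := by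
      rw [Finset.prod_congr rfl fun i hi => by rw [hg2 i hi], Finset.prod_map]
      simp
    rw [hEE, hP, Finset.prod_union hdisj, hPE, hPE, e1, e2,
      ENNReal.ofReal_mul (Finset.prod_nonneg fun i _ => (hp _).le)]
  have hX : ∀ (j : ℕ) (ω : Om m),
      {ω : Om m | ∀ i ∈ s, ω i = f i}.indicator (fun _ => (1 : ℝ)) (shift^[j] ω)
        = (E j).indicator (fun _ => (1 : ℝ)) ω := by
    intro j ω
    have : shift^[j] ω ∈ {ω : Om m | ∀ i ∈ s, ω i = f i} ↔ ω ∈ E j := by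
      simp [hE, shift_iter]
    classical
    simp only [Set.indicator_apply, this]
  set L := 2 * k + 1 with hL
  have main : ∀ r, ∀ᵐ ω ∂P, Tendsto (fun n : ℕ => (∑ i ∈ Finset.range n,
      (E (i * L + r + 1)).indicator (fun _ => (1 : ℝ)) ω) / n) atTop
      (𝓝 (P.real {ω : Om m | ∀ i ∈ s, ω i = f i})) := by
    intro r
    have := indicator_slln P (fun i => E (i * L + r + 1)) (fun i => hEm _)
      (fun i => by rw [hPE, hPE]) (fun i j hij => hind _ _ (by
        have : (i + 1) * L ≤ j * L := Nat.mul_le_mul_right _ hij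
        rw [Nat.succ_mul] at this
        omega))
    rw [hreal] at this
    exact this
  rw [← ae_all_iff] at main
  filter_upwards [main] with ω hω
  refine cesaro_of_residues _ ?_ ?_ L (by omega) _ ?_
  · intro j; exact Set.indicator_nonneg (fun _ _ => zero_le_one) _
  · intro j; exact Set.indicator_le_self' (f := fun _ => (1 : ℝ)) (fun _ _ => zero_le_one) _
  · intro r _
    refine (hω r).congr fun n => ?_
    simp only [hX]

lemma sum_Ioc_eq (f : ℕ → ℝ) {a b : ℕ} (hab : a ≤ b) :
    ∑ j ∈ Finset.Ioc a b, f j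
      = ∑ j ∈ Finset.range b, f (j + 1) - ∑ j ∈ Finset.range a, f (j + 1) := by
  induction b, hab using Nat.le_induction with
  | base => simp
  | succ b hb ih => rw [Finset.sum_Ioc_succ_top hb, ih, Finset.sum_range_succ]; ring

lemma floor_avg (F : ℕ → ℝ) (c : ℝ) (hF0 : F 0 = 0)
    (hF : Tendsto (fun n : ℕ => F n / n) atTop (𝓝 c)) (u : ℝ) (hu : 0 ≤ u) :
    Tendsto (fun n : ℕ => F ⌊(n : ℝ) * u⌋₊ / n) atTop (𝓝 (u * c)) := by
  rcases hu.eq_or_lt with rfl | hu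
  · simp [hF0]
  have h1 : Tendsto (fun n : ℕ => ⌊(n : ℝ) * u⌋₊) atTop atTop :=
    tendsto_nat_floor_atTop.comp (tendsto_natCast_atTop_atTop.atTop_mul_const hu)
  have h2 : Tendsto (fun n : ℕ => ((⌊(n : ℝ) * u⌋₊ : ℕ) : ℝ) / n) atTop (𝓝 u) := by
    refine ((tendsto_nat_floor_mul_div_atTop (R := ℝ) hu.le).comp
      tendsto_natCast_atTop_atTop).congr fun n => ?_
    simp [mul_comm]
  have h3 := h2.mul (hF.comp h1)
  refine h3.congr' ?_
  filter_upwards [h1.eventually_gt_atTop 0] with n hn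
  have : (0 : ℝ) < (⌊(n : ℝ) * u⌋₊ : ℕ) := by exact_mod_cast hn
  simp only [Function.comp]
  field_simp

/-- Words on the window `[-k, k]`. -/
abbrev Wd (m k : ℕ) := (Finset.Icc (-(k : ℤ)) (k : ℤ)) → Fin m

/-- Extension of a word to a bi-infinite sequence. -/
def extW {m : ℕ} (hm : 1 ≤ m) (k : ℕ) (w : Wd m k) : Om m :=
  fun i => if hi : i ∈ Finset.Icc (-(k : ℤ)) (k : ℤ) then w ⟨i, hi⟩ else ⟨0, hm⟩

/-- Restriction of a sequence to the window. -/
def resW {m : ℕ} (k : ℕ) (ω : Om m) : Wd m k := fun i => ω i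

/-- The cylinder of a word. -/
def cylW {m : ℕ} (hm : 1 ≤ m) (k : ℕ) (w : Wd m k) : Set (Om m) :=
  {ω : Om m | ∀ i ∈ Finset.Icc (-(k : ℤ)) k, ω i = extW hm k w i}

lemma mem_cylW {m : ℕ} (hm : 1 ≤ m) (k : ℕ) (w : Wd m k) (ω : Om m) :
    ω ∈ cylW hm k w ↔ resW k ω = w := by
  constructor
  · intro hω
    funext i
    have h1 : ω i = extW hm k w i := hω i i.2
    simp only [resW, h1, extW]
    rw [dif_pos i.2]
  · rintro rfl i hi
    simp only [extW, resW]
    rw [dif_pos hi]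

lemma ext_res_agree {m : ℕ} (hm : 1 ≤ m) (k : ℕ) (ω : Om m) :
    ∀ ℓ : ℤ, |ℓ| ≤ (k : ℤ) → ω ℓ = extW hm k (resW k ω) ℓ := by
  intro ℓ hℓ
  have : ℓ ∈ Finset.Icc (-(k : ℤ)) (k : ℤ) := Finset.mem_Icc.2 (abs_le.1 hℓ)
  simp only [extW, resW]
  rw [dif_pos this]

lemma sum_words {m : ℕ} (hm : 1 ≤ m) (k : ℕ) (φ : Om m → ℝ) (ω : Om m) :
    φ (extW hm k (resW k ω))
      = ∑ w : Wd m k, φ (extW hm k w) * (cylW hm k w).indicator (fun _ => (1 : ℝ)) ω := by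
  classical
  simp only [Set.indicator_apply, mem_cylW]
  simp

lemma lintegral_words {m : ℕ} (hm : 1 ≤ m) (k : ℕ) (P : Measure (Om m)) (φ : Om m → ENNReal) :
    Measurable (fun ω : Om m => φ (extW hm k (resW k ω))) ∧
    ∫⁻ ω, φ (extW hm k (resW k ω)) ∂P
      = ∑ w : Wd m k, φ (extW hm k w) * P (cylW hm k w) := by
  have hr : Measurable (resW k : Om m → Wd m k) :=
    measurable_pi_lambda _ fun i => measurable_pi_apply _
  have hφ : Measurable (fun w : Wd m k => φ (extW hm k w)) := measurable_of_finite _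
  refine ⟨hφ.comp hr, ?_⟩
  rw [← lintegral_map (f := fun w : Wd m k => φ (extW hm k w)) hφ hr, lintegral_fintype]
  refine Finset.sum_congr rfl fun w _ => ?_
  rw [Measure.map_apply hr (measurableSet_singleton _)]
  congr 2
  ext ω
  simp [mem_cylW]

lemma core {m : ℕ} (hm : 1 ≤ m) (P : Measure (Om m)) (ω : Om m)
    (hω : ∀ (k : ℕ) (w : Wd m k), Tendsto (fun n : ℕ => (∑ j ∈ Finset.range n,
        (cylW hm k w).indicator (fun _ => (1 : ℝ)) (shift^[j + 1] ω)) / n)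
      atTop (𝓝 (P.real (cylW hm k w))))
    (a : ℕ → Om m → ℝ) (abar : ℕ → ℝ) (B D κ : ℝ) (hD : 0 ≤ D) (hκ : κ ∈ Set.Ioo (0 : ℝ) 1)
    (ha0 : ∀ n ω, 0 ≤ a n ω) (haB : ∀ n, 1 ≤ n → ∀ ω, a n ω ≤ B / n)
    (hlip : ∀ n, 1 ≤ n → ∀ k ω, |a n ω - a n (extW hm k (resW k ω))| ≤ D * κ ^ k / n)
    (hbar : ∀ n, 1 ≤ n → ∀ k, |abar n - ∑ w : Wd m k, a n (extW hm k w) * P.real (cylW hm k w)|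
      ≤ D * κ ^ k / n) (s t : ℝ) (hs : 0 ≤ s) (hst : s < t) :
    Tendsto (fun n : ℕ =>
        (∑ j ∈ Finset.Ioc ⌊(n : ℝ) * s⌋₊ ⌊(n : ℝ) * t⌋₊, a n (shift^[j] ω))
          - (n : ℝ) * (t - s) * abar n) atTop (𝓝 0) := by
  have ht : 0 < t := hs.trans_lt hst
  rw [Metric.tendsto_atTop']
  intro ε hε
  -- choose k
  obtain ⟨k, hk⟩ : ∃ k : ℕ, 2 * t * D * κ ^ k < ε / 2 := by
    have : Tendsto (fun k : ℕ => 2 * t * D * κ ^ k) atTop (𝓝 (2 * t * D * 0)) :=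
      (tendsto_pow_atTop_nhds_zero_of_lt_one hκ.1.le hκ.2).const_mul _
    rw [mul_zero] at this
    exact (this.eventually_lt_const (half_pos hε)).exists
  set X : Wd m k → ℕ → ℝ := fun w j =>
    (cylW hm k w).indicator (fun _ => (1 : ℝ)) (shift^[j] ω) with hX
  have hfreq : ∀ w : Wd m k, Tendsto (fun n : ℕ =>
      (∑ j ∈ Finset.Ioc ⌊(n : ℝ) * s⌋₊ ⌊(n : ℝ) * t⌋₊, X w j) / n
        - (t - s) * P.real (cylW hm k w)) atTop (𝓝 0) := by
    intro w
    have h1 := floor_avg (fun n => ∑ j ∈ Finset.range n, X w (j + 1)) _ (by simp) (hω k w) t ht.le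
    have h2 := floor_avg (fun n => ∑ j ∈ Finset.range n, X w (j + 1)) _ (by simp) (hω k w) s hs
    have h3 := (h1.sub h2).sub_const ((t - s) * P.real (cylW hm k w))
    have h4 : t * P.real (cylW hm k w) - s * P.real (cylW hm k w)
      - (t - s) * P.real (cylW hm k w) = 0 := by ring
    rw [h4] at h3
    refine h3.congr fun n => ?_
    rw [sum_Ioc_eq _ (Nat.floor_le_floor (by gcongr)), sub_div]
  set R : ℕ → ℝ := fun n => ∑ w : Wd m k, (n * a n (extW hm k w)) *
    ((∑ j ∈ Finset.Ioc ⌊(n : ℝ) * s⌋₊ ⌊(n : ℝ) * t⌋₊, X w j) / n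
        - (t - s) * P.real (cylW hm k w)) with hR
  have hR0 : Tendsto R atTop (𝓝 0) := by
    have : Tendsto R atTop (𝓝 (∑ w : Wd m k, (0 : ℝ))) := by
      refine tendsto_finsetSum _ fun w _ => ?_
      have h1 := ((hfreq w).abs).const_mul B
      simp only [abs_zero, mul_zero] at h1
      refine squeeze_zero_norm' ?_ h1
      filter_upwards [eventually_ge_atTop 1] with n hn
      have hn' : (0 : ℝ) < n := by exact_mod_cast hn
      rw [Real.norm_eq_abs, abs_mul]
      gcongr
      rw [abs_of_nonneg (mul_nonneg hn'.le (ha0 _ _))]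
      have := haB n hn (extW hm k w)
      rw [le_div_iff₀ hn'] at this
      linarith
    simpa using this
  obtain ⟨N, hN⟩ := Metric.tendsto_atTop.1 hR0 (ε / 2) (half_pos hε)
  refine ⟨max N 1, fun n hn => ?_⟩
  have hn1 : 1 ≤ n := (le_max_right N 1).trans hn.le
  have hn' : (0 : ℝ) < n := by exact_mod_cast hn1
  have hRn := hN n ((le_max_left N 1).trans hn.le)
  rw [Real.dist_eq, sub_zero] at hRn ⊢
  set J := Finset.Ioc ⌊(n : ℝ) * s⌋₊ ⌊(n : ℝ) * t⌋₊ with hJ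
  have hcard : (J.card : ℝ) ≤ n * t := by
    rw [hJ, Nat.card_Ioc]
    refine le_trans ?_ (Nat.floor_le (by positivity : 0 ≤ (n : ℝ) * t))
    exact_mod_cast Nat.sub_le _ _
  set δ := D * κ ^ k / n with hδ
  have hδ0 : 0 ≤ δ := by have := hκ.1; positivity
  have e1 : |∑ j ∈ J, (a n (shift^[j] ω) - a n (extW hm k (resW k (shift^[j] ω))))| ≤ n * t * δ :=
    calc _ ≤ ∑ j ∈ J, |a n (shift^[j] ω) - a n (extW hm k (resW k (shift^[j] ω)))| :=
          Finset.abs_sum_le_sum_abs _ _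
      _ ≤ ∑ j ∈ J, δ := Finset.sum_le_sum fun j _ => hlip n hn1 k _
      _ = J.card * δ := by simp
      _ ≤ n * t * δ := by gcongr
  set b := ∑ w : Wd m k, a n (extW hm k w) * P.real (cylW hm k w) with hb
  have e2 : |(n : ℝ) * (t - s) * (abar n - b)| ≤ n * t * δ := by
    rw [abs_mul, abs_of_nonneg (mul_nonneg hn'.le (by linarith))]
    have := hbar n hn1 k
    gcongr
    linarith
  have e3 : R n = ∑ j ∈ J, a n (extW hm k (resW k (shift^[j] ω))) - n * (t - s) * b := by
    simp only [sum_words hm k (a n) (shift^[_] ω)]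
    rw [Finset.sum_comm, hb, Finset.mul_sum, ← Finset.sum_sub_distrib, hR]
    refine Finset.sum_congr rfl fun w _ => ?_
    rw [← Finset.mul_sum]
    simp only [hX, hJ]
    field_simp
  have e4 : ∑ j ∈ J, a n (shift^[j] ω) - n * (t - s) * abar n
      = ∑ j ∈ J, (a n (shift^[j] ω) - a n (extW hm k (resW k (shift^[j] ω))))
        - (n : ℝ) * (t - s) * (abar n - b) + R n := by
    rw [e3, Finset.sum_sub_distrib]; ring
  have e5 : n * t * δ = t * D * κ ^ k := by rw [hδ]; field_simp
  rw [e4]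
  have := abs_add_le (∑ j ∈ J, (a n (shift^[j] ω) - a n (extW hm k (resW k (shift^[j] ω))))
        - (n : ℝ) * (t - s) * (abar n - b)) (R n)
  have := abs_sub (∑ j ∈ J, (a n (shift^[j] ω) - a n (extW hm k (resW k (shift^[j] ω)))))
        ((n : ℝ) * (t - s) * (abar n - b))
  linarith

theorem stmt5 (m : ℕ) (hm : 1 ≤ m)
    (p : Fin m → ℝ) (hp : ∀ i, 0 < p i) (hp1 : ∑ i, p i = 1)
    (P : Measure (Om m)) (hPprob : IsProbabilityMeasure P)
    -- `P` is the Bernoulli product measure `(p_1, …, p_m)^{⊗ℤ}`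
    (hP : ∀ (s : Finset ℤ) (f : ℤ → Fin m),
      P {ω | ∀ i ∈ s, ω i = f i} = ENNReal.ofReal (∏ i ∈ s, p (f i)))
    -- the fiberwise measures `ν^ω` with densities `h_ω` with respect to Lebesgue
    (ν : Om m → Measure ℝ) (hνprob : ∀ ω, IsProbabilityMeasure (ν ω))
    (h : Om m → ℝ → ℝ) (hmeas : ∀ ω, Measurable (h ω))
    (hdens : ∀ ω, ν ω = mLeb.withDensity (fun x => ENNReal.ofReal (h ω x)))
    -- the densities are uniformly bounded above and below
    (C : ℝ) (hC : 0 < C)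
    (hbound : ∀ᵐ ω ∂P, ∀ᵐ x ∂mLeb, C⁻¹ ≤ h ω x ∧ h ω x ≤ C)
    -- `ω ↦ h_ω ∈ L^∞(m)` is Hölder continuous with respect to `d_θ`
    (K₀ : ℝ) (hK₀ : 0 < K₀) (κ : ℝ) (hκ : κ ∈ Set.Ioo (0 : ℝ) 1)
    (hHolder : ∀ (n : ℕ) (ω ω' : Om m), (∀ ℓ : ℤ, |ℓ| ≤ (n : ℤ) → ω ℓ = ω' ℓ) →
      ∀ᵐ x ∂mLeb, |h ω x - h ω' x| ≤ K₀ * κ ^ n)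
    -- the annealed measure `ν(A) = ∫ ν^ω(A) d𝐏(ω)`
    (νa : Measure ℝ)
    (hνa : ∀ A : Set ℝ, MeasurableSet A → νa A = ∫⁻ ω, ν ω A ∂P)
    -- the sets `A_n ⊆ [0,1]` with `m(A_n) ≤ K/n`
    (A : ℕ → Set ℝ) (hAmeas : ∀ n, MeasurableSet (A n)) (hAsub : ∀ n, A n ⊆ Set.Icc 0 1)
    (K : ℝ) (hK : 0 < K)
    (hA : ∀ n : ℕ, 1 ≤ n → mLeb (A n) ≤ ENNReal.ofReal (K / n)) :
    ∀ᵐ ω ∂P, ∀ s t : ℝ, 0 ≤ s → s < t →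
      Tendsto (fun n : ℕ =>
        (∑ j ∈ Finset.Ioc ⌊(n : ℝ) * s⌋₊ ⌊(n : ℝ) * t⌋₊, ((ν (shift^[j] ω)) (A n)).toReal)
          - (n : ℝ) * (t - s) * (νa (A n)).toReal)
        atTop (𝓝 0) := by

  have hb : ∀ ω, ∀ᵐ x ∂mLeb, h ω x ≤ C + K₀ := by
    intro ω
    have hpos : P {ω' : Om m | ∀ i ∈ ({0} : Finset ℤ), ω' i = ω i} ≠ 0 := by
      rw [hP {0} ω]
      simpa using hp (ω 0)
    obtain ⟨ω', h1, h2⟩ := ((frequently_ae_iff.2 hpos).and_eventually hbound).exists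
    have h3 := hHolder 0 ω ω' (by
      intro ℓ hℓ
      have : ℓ = 0 := by simpa using hℓ
      subst this
      exact (h1 0 (by simp)).symm)
    filter_upwards [h2, h3] with x hx hx'
    have := (abs_le.1 hx').2
    simp only [pow_zero, mul_one] at this
    linarith [hx.2]
  have hκ0 := hκ.1
  have hup : ∀ n, 1 ≤ n → ∀ ω, ν ω (A n) ≤ ENNReal.ofReal ((C + K₀) * K / n) := by
    intro n hn ω
    rw [hdens ω, withDensity_apply _ (hAmeas n)]
    calc ∫⁻ x in A n, ENNReal.ofReal (h ω x) ∂mLeb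
        ≤ ∫⁻ x in A n, ENNReal.ofReal (C + K₀) ∂mLeb := by
          refine lintegral_mono_ae (ae_restrict_of_ae ?_)
          filter_upwards [hb ω] with x hx
          exact ENNReal.ofReal_le_ofReal hx
      _ = ENNReal.ofReal (C + K₀) * mLeb (A n) := by simp
      _ ≤ ENNReal.ofReal (C + K₀) * ENNReal.ofReal (K / n) := by gcongr; exact hA n hn
      _ = ENNReal.ofReal ((C + K₀) * K / n) := by
          rw [← ENNReal.ofReal_mul (by positivity), mul_div_assoc]
  have hlip : ∀ n, 1 ≤ n → ∀ (k : ℕ) (ω ω' : Om m), (∀ ℓ : ℤ, |ℓ| ≤ (k : ℤ) → ω ℓ = ω' ℓ) →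
      ν ω (A n) ≤ ν ω' (A n) + ENNReal.ofReal (K₀ * K * κ ^ k / n) := by
    intro n hn k ω ω' hag
    rw [hdens ω, hdens ω', withDensity_apply _ (hAmeas n), withDensity_apply _ (hAmeas n)]
    calc ∫⁻ x in A n, ENNReal.ofReal (h ω x) ∂mLeb
        ≤ ∫⁻ x in A n, (ENNReal.ofReal (h ω' x) + ENNReal.ofReal (K₀ * κ ^ k)) ∂mLeb := by
          refine lintegral_mono_ae (ae_restrict_of_ae ?_)
          filter_upwards [hHolder k ω ω' hag] with x hx
          refine le_trans (ENNReal.ofReal_le_ofReal ?_) ENNReal.ofReal_add_le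
          linarith [(abs_le.1 hx).2]
      _ = ∫⁻ x in A n, ENNReal.ofReal (h ω' x) ∂mLeb
            + ENNReal.ofReal (K₀ * κ ^ k) * mLeb (A n) := by
          rw [lintegral_add_right _ measurable_const]; simp
      _ ≤ ∫⁻ x in A n, ENNReal.ofReal (h ω' x) ∂mLeb
            + ENNReal.ofReal (K₀ * κ ^ k) * ENNReal.ofReal (K / n) := by gcongr; exact hA n hn
      _ = _ := by
          rw [← ENNReal.ofReal_mul (by positivity)]
          congr 2
          ring
  have habs : ∀ (x y : ENNReal) (d : ℝ), x ≠ ⊤ → y ≠ ⊤ → 0 ≤ d → x ≤ y + ENNReal.ofReal d →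
      y ≤ x + ENNReal.ofReal d → |x.toReal - y.toReal| ≤ d := by
    intro x y d hx hy hd h1 h2
    have h1' := ENNReal.toReal_mono (by finiteness) h1
    have h2' := ENNReal.toReal_mono (by finiteness) h2
    rw [ENNReal.toReal_add (by finiteness) (by finiteness), ENNReal.toReal_ofReal hd] at h1' h2'
    rw [abs_le]
    constructor <;> linarith
  have hgen : ∀ᵐ ω ∂P, ∀ (k : ℕ) (w : Wd m k), Tendsto (fun n : ℕ => (∑ j ∈ Finset.range n,
        (cylW hm k w).indicator (fun _ => (1 : ℝ)) (shift^[j + 1] ω)) / n)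
      atTop (𝓝 (P.real (cylW hm k w))) := by
    rw [ae_all_iff]
    intro k
    rw [ae_all_iff]
    intro w
    exact cyl_slln m p hp P hP k (extW hm k w)
  filter_upwards [hgen] with ω hω s t hs hst
  refine core hm P ω hω (fun n ω => (ν ω (A n)).toReal) (fun n => (νa (A n)).toReal)
    ((C + K₀) * K) (K₀ * K) κ (by positivity) hκ (fun _ _ => ENNReal.toReal_nonneg) ?_ ?_ ?_ s t hs hst
  · intro n hn ω
    exact ENNReal.toReal_le_of_le_ofReal (by positivity) (hup n hn ω)
  · intro n hn k ω
    exact habs _ _ _ (measure_ne_top _ _) (measure_ne_top _ _) (by positivity)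
      (hlip n hn k _ _ (ext_res_agree hm k ω))
      (hlip n hn k _ _ fun ℓ hℓ => (ext_res_agree hm k ω ℓ hℓ).symm)
  · intro n hn k
    obtain ⟨hmw, hw⟩ := lintegral_words hm k P (fun ω => ν ω (A n))
    have e : ∑ w : Wd m k, (ν (extW hm k w) (A n)).toReal * P.real (cylW hm k w)
        = (∑ w : Wd m k, ν (extW hm k w) (A n) * P (cylW hm k w)).toReal := by
      rw [ENNReal.toReal_sum (fun w _ => by finiteness)]
      exact Finset.sum_congr rfl fun w _ => by rw [ENNReal.toReal_mul, measureReal_def]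
    rw [e]
    have hconst : ∀ d : ENNReal, ∫⁻ _ : Om m, d ∂P = d := by intro d; simp
    refine habs _ _ _ ?_ ?_ (by positivity) ?_ ?_
    · rw [hνa _ (hAmeas n)]
      refine ne_top_of_le_ne_top ENNReal.one_ne_top ?_
      calc ∫⁻ ω, ν ω (A n) ∂P ≤ ∫⁻ _ : Om m, 1 ∂P := lintegral_mono fun ω => prob_le_one
        _ = 1 := hconst 1
    · exact ENNReal.sum_ne_top.2 fun w _ => by finiteness
    · rw [hνa _ (hAmeas n), ← hw]
      refine (lintegral_mono fun ω => hlip n hn k _ _ (ext_res_agree hm k ω)).trans_eq ?_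
      rw [lintegral_add_right _ measurable_const, hconst]
    · rw [hνa _ (hAmeas n), ← hw]
      refine (lintegral_mono fun ω => hlip n hn k _ _
        fun ℓ hℓ => (ext_res_agree hm k ω ℓ hℓ).symm).trans_eq ?_
      rw [lintegral_add_right _ measurable_const, hconst]
end
end

section
/- Let 𝒮 = {T_1,…,T_m} be a finite collection of piecewise C² uniformly expanding maps of [0,1] (for each T ∈ 𝒮 a finite interval partition 𝒜_T on whose pieces T extends to a strictly monotone C² map of the closure, with min_T min_I inf |T'| = λ > 1). Let Ω := {1,…,m}^ℤ carry the Bernoulli product measure 𝐏 := (p_1,…,p_m)^{⊗ℤ} (all p_i > 0) with left shift σ, write T_ω^n := T_{ω_{n−1}} ∘ ⋯ ∘ T_{ω_0}, let m be Lebesgue measure on [0,1], and for measurable U ⊆ [0,1] let R_U(ω)(x) := inf{ k ≥ 1 : T_ω^k(x) ∈ U }. Suppose a > 0 and 3/4 < ψ < 1. Then for m-a.e. x0 ∈ [0,1] and 𝐏-a.e. ω ∈ Ω: lim_{n→∞} (log n) · Σ_{i=0}^{n−1} m( B_{n^{−ψ}}(x0) ∩ { x : R_{B_{n^{−ψ}}(x0)}(σ^i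 ω)(x) ≤ ⌊a log n⌋ } ) = 0, where B_r(x0) := { x ∈ [0,1] : |x − x0| < r }. -/
open MeasureTheory Filter Set Topology

noncomputable section

/-- `T` is a piecewise `C²` uniformly expanding map of `[0,1]` with expansion constant `lam`. -/
def PiecewiseC2Expanding (T : ℝ → ℝ) (lam : ℝ) : Prop :=
  ∃ (N : ℕ) (a : ℕ → ℝ), 1 ≤ N ∧ a 0 = 0 ∧ a N = 1 ∧ (∀ i < N, a i < a (i + 1)) ∧
    ∀ i < N, ∃ g : ℝ → ℝ,
      ContDiffOn ℝ 2 g (Set.Icc (a i) (a (i + 1))) ∧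
      Set.EqOn T g (Set.Ioo (a i) (a (i + 1))) ∧
      (StrictMonoOn g (Set.Icc (a i) (a (i + 1))) ∨
        StrictAntiOn g (Set.Icc (a i) (a (i + 1)))) ∧
      ∀ x ∈ Set.Icc (a i) (a (i + 1)),
        lam ≤ |derivWithin g (Set.Icc (a i) (a (i + 1))) x|

/-- The random composition `T_ω^n = T_{ω_{n−1}} ∘ ⋯ ∘ T_{ω_0}`. -/
def randComp {m : ℕ} (T : Fin m → ℝ → ℝ) (ω : Om m) : ℕ → ℝ → ℝ
  | 0 => fun x => x
  | n + 1 => fun x => T (ω (n : ℤ)) (randComp T ω n x)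

/-- The event `{x : R_U(ω)(x) ≤ N}` that the random orbit hits `U` within `N` steps. -/
def hitWithin {m : ℕ} (T : Fin m → ℝ → ℝ) (ω : Om m) (U : Set ℝ) (N : ℕ) : Set ℝ :=
  {x | ∃ k : ℕ, 1 ≤ k ∧ k ≤ N ∧ randComp T ω k x ∈ U}

/-- Regular part of a map of `[0,1]` off a finite set `S`. -/
structure NB (h : ℝ → ℝ) (D : ℝ) (S : Set ℝ) : Prop where
  fin : S.Finite
  zero : (0 : ℝ) ∈ S
  one : (1 : ℝ) ∈ S
  maps : MapsTo h (Icc 0 1) (Icc 0 1)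
  fto : ∀ y, {x | x ∈ Icc (0:ℝ) 1 \ S ∧ h x = y}.Finite
  diff : ∀ x ∈ Icc (0:ℝ) 1 \ S, DifferentiableAt ℝ h x
  exp : ∀ x ∈ Icc (0:ℝ) 1 \ S, D ≤ |deriv h x|

/-- Log-derivative. -/
def ld (h : ℝ → ℝ) (x : ℝ) : ℝ := Real.log |deriv h x|

/-- Lipschitz log-derivative on pieces. -/
def LipLog (h : ℝ → ℝ) (L : ℝ) (S : Set ℝ) : Prop :=
  ∀ x y, uIcc x y ⊆ Icc (0:ℝ) 1 \ S →
    |ld h x - ld h y| ≤ L * |x - y|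

/-- Bounded distortion on pieces. -/
def Dst (h : ℝ → ℝ) (c : ℝ) (S : Set ℝ) : Prop :=
  ∀ x y, uIcc x y ⊆ Icc (0:ℝ) 1 \ S →
    |ld h x - ld h y| ≤ c * |h x - h y|

lemma mvt_abs (h : ℝ → ℝ) (x y : ℝ)
    (hd : ∀ z ∈ uIcc x y, DifferentiableAt ℝ h z) :
    ∃ z ∈ uIcc x y, |h x - h y| = |deriv h z| * |x - y| := by
  wlog hxy : x ≤ y generalizing x y
  · obtain ⟨z, hz, e⟩ := this y x (by rwa [uIcc_comm]) (le_of_not_ge hxy)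
    exact ⟨z, by rwa [uIcc_comm], by rw [abs_sub_comm, e, abs_sub_comm x]⟩
  rcases hxy.eq_or_lt with rfl | hlt
  · exact ⟨x, by simp, by simp⟩
  rw [uIcc_of_le hxy] at hd ⊢
  obtain ⟨z, hz, e⟩ := exists_deriv_eq_slope h hlt
    (fun t ht => (hd t ht).continuousAt.continuousWithinAt)
    (fun t ht => (hd t (Ioo_subset_Icc_self ht)).differentiableWithinAt)
  refine ⟨z, Ioo_subset_Icc_self hz, ?_⟩
  have : y - x ≠ 0 := by linarith
  rw [abs_sub_comm, abs_sub_comm x, ← abs_mul, e]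
  congr 1; field_simp

lemma expand_of {h : ℝ → ℝ} {D : ℝ} {x y : ℝ}
    (hd : ∀ z ∈ uIcc x y, DifferentiableAt ℝ h z)
    (he : ∀ z ∈ uIcc x y, D ≤ |deriv h z|) : D * |x - y| ≤ |h x - h y| := by
  obtain ⟨z, hz, e⟩ := mvt_abs h x y hd
  rw [e]; gcongr; exact he z hz

lemma NB.comp {h g : ℝ → ℝ} {D E : ℝ} {S R : Set ℝ} (hD : 0 ≤ D)
    (hh : NB h D S) (hg : NB g E R) :
    NB (fun x => g (h x)) (E * D) (S ∪ {x | x ∈ Icc (0:ℝ) 1 \ S ∧ h x ∈ R}) := by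
  have key : ∀ x ∈ Icc (0:ℝ) 1 \ (S ∪ {x | x ∈ Icc (0:ℝ) 1 \ S ∧ h x ∈ R}),
      x ∈ Icc (0:ℝ) 1 \ S ∧ h x ∈ Icc (0:ℝ) 1 \ R := by
    rintro x ⟨hx, hx'⟩
    simp only [mem_union, mem_ofPred_eq, not_or, not_and] at hx'
    exact ⟨⟨hx, hx'.1⟩, hh.maps hx, hx'.2 ⟨hx, hx'.1⟩⟩
  have dv : ∀ x ∈ Icc (0:ℝ) 1 \ (S ∪ {x | x ∈ Icc (0:ℝ) 1 \ S ∧ h x ∈ R}),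
      deriv (fun x => g (h x)) x = deriv g (h x) * deriv h x := by
    intro x hx
    obtain ⟨h1, h2⟩ := key x hx
    exact deriv_comp x (hg.diff _ h2) (hh.diff _ h1)
  refine ⟨?_, Or.inl hh.zero, Or.inl hh.one, hg.maps.comp hh.maps, ?_, ?_, ?_⟩
  · refine hh.fin.union ?_
    refine (hg.fin.biUnion (fun y _ => hh.fto y)).subset ?_
    rintro x ⟨hx, hx'⟩
    simp only [mem_iUnion]
    exact ⟨h x, hx', hx, rfl⟩
  · intro y
    refine ((hg.fto y).biUnion (fun z _ => hh.fto z)).subset ?_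
    rintro x ⟨hx, hx'⟩
    obtain ⟨h1, h2⟩ := key x hx
    simp only [mem_iUnion]
    exact ⟨h x, ⟨h2, hx'⟩, h1, rfl⟩
  · intro x hx
    obtain ⟨h1, h2⟩ := key x hx
    exact (hg.diff _ h2).comp x (hh.diff _ h1)
  · intro x hx
    obtain ⟨h1, h2⟩ := key x hx
    rw [dv x hx, abs_mul]
    exact mul_le_mul (hg.exp _ h2) (hh.exp _ h1) hD (abs_nonneg _)

lemma Dst.comp {h g : ℝ → ℝ} {D lam c L : ℝ} {S R : Set ℝ} (hD : 0 < D) (hlam : 1 < lam)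
    (hL : 0 ≤ L) (hc : c = L / (lam - 1))
    (hh : NB h D S) (hg : NB g lam R) (dh : Dst h c S) (dg : LipLog g L R) :
    Dst (fun x => g (h x)) c (S ∪ {x | x ∈ Icc (0:ℝ) 1 \ S ∧ h x ∈ R}) := by
  intro x y hxy
  have key : ∀ x ∈ Icc (0:ℝ) 1 \ (S ∪ {x | x ∈ Icc (0:ℝ) 1 \ S ∧ h x ∈ R}),
      x ∈ Icc (0:ℝ) 1 \ S ∧ h x ∈ Icc (0:ℝ) 1 \ R := by
    rintro x ⟨hx, hx'⟩
    simp only [mem_union, mem_ofPred_eq, not_or, not_and] at hx'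
    exact ⟨⟨hx, hx'.1⟩, hh.maps hx, hx'.2 ⟨hx, hx'.1⟩⟩
  have dv : ∀ x ∈ Icc (0:ℝ) 1 \ (S ∪ {x | x ∈ Icc (0:ℝ) 1 \ S ∧ h x ∈ R}),
      deriv (fun x => g (h x)) x = deriv g (h x) * deriv h x := by
    intro x hx
    obtain ⟨h1, h2⟩ := key x hx
    exact deriv_comp x (hg.diff _ h2) (hh.diff _ h1)
  have lg : ∀ x ∈ Icc (0:ℝ) 1 \ (S ∪ {x | x ∈ Icc (0:ℝ) 1 \ S ∧ h x ∈ R}),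
      ld (fun x => g (h x)) x = ld g (h x) + ld h x := by
    intro x hx
    obtain ⟨h1, h2⟩ := key x hx
    have := hh.exp _ h1
    have := hg.exp _ h2
    unfold ld
    rw [dv x hx, abs_mul, Real.log_mul (by linarith) (by linarith)]
  have cont : ContinuousOn h (uIcc x y) := fun t ht =>
    (hh.diff t (key t (hxy ht)).1).continuousAt.continuousWithinAt
  have sub : uIcc (h x) (h y) ⊆ Icc (0:ℝ) 1 \ R := by
    intro z hz
    obtain ⟨t, ht, rfl⟩ := intermediate_value_uIcc cont hz
    exact (key t (hxy ht)).2
  have h1 := dh x y (fun t ht => (key t (hxy ht)).1)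
  have h2 := dg _ _ sub
  have h3 := expand_of (h := g) (D := lam) (fun z hz => hg.diff z (sub hz))
    (fun z hz => hg.exp z (sub hz))
  rw [lg x (hxy left_mem_uIcc), lg y (hxy right_mem_uIcc)]
  have hcl : c + L = c * lam := by
    have : lam - 1 ≠ 0 := by linarith
    rw [hc]; field_simp; ring
  have hc0 : 0 ≤ c := by rw [hc]; exact div_nonneg hL (by linarith)
  calc _ ≤ |ld g (h x) - ld g (h y)|
          + |ld h x - ld h y| := by
        refine le_trans (le_of_eq ?_) (abs_add_le _ _); congr 1; ring
    _ ≤ L * |h x - h y| + c * |h x - h y| := add_le_add h2 h1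
    _ = c * (lam * |h x - h y|) := by rw [← mul_assoc, ← hcl]; ring
    _ ≤ _ := by gcongr

lemma NB.id : NB (fun x => x) 1 {0, 1} := by
  refine ⟨by simp, by simp, by simp, fun x hx => hx, ?_, ?_, ?_⟩
  · intro y
    refine (finite_singleton y).subset ?_
    rintro x ⟨_, hx⟩; exact hx
  · intro x _; exact differentiableAt_id
  · intro x _; simp

/-- Singular set of the random composition. -/
def Sing {m : ℕ} (T : Fin m → ℝ → ℝ) (R : Fin m → Set ℝ) (ω : Om m) : ℕ → Set ℝ
  | 0 => {0, 1}
  | n + 1 => Sing T R ω n ∪ {x | x ∈ Icc (0:ℝ) 1 \ Sing T R ω n ∧ randComp T ω n x ∈ R (ω (n : ℤ))}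

lemma sing_nice {m : ℕ} (T : Fin m → ℝ → ℝ) (R : Fin m → Set ℝ) (lam L c : ℝ) (hlam : 1 < lam)
    (hL : 0 ≤ L) (hc : c = L / (lam - 1))
    (hT : ∀ i, NB (T i) lam (R i) ∧ LipLog (T i) L (R i)) (ω : Om m) (k : ℕ) :
    NB (randComp T ω k) (lam ^ k) (Sing T R ω k) ∧ Dst (randComp T ω k) c (Sing T R ω k) := by
  have hc0 : 0 ≤ c := by rw [hc]; exact div_nonneg hL (by linarith)
  induction k with
  | zero =>
    refine ⟨by rw [pow_zero]; exact NB.id, ?_⟩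
    intro x y _
    have : ∀ t, ld (randComp T ω 0) t = 0 := by
      intro t; simp [ld, randComp]
    rw [this, this]; simp; positivity
  | succ k ih =>
    obtain ⟨h1, h2⟩ := ih
    obtain ⟨g1, g2⟩ := hT (ω k)
    have e1 := NB.comp (by positivity) h1 g1
    have e2 := Dst.comp (by positivity) hlam hL hc h1 g1 h2 g2
    rw [← pow_succ'] at e1
    exact ⟨e1, e2⟩

lemma shift_iterate_apply {m : ℕ} (ω : Om m) (k : ℕ) (j : ℤ) : (shift^[k] ω) j = ω (j + k) := by
  induction k generalizing j with
  | zero => simp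
  | succ k ih =>
    rw [Function.iterate_succ_apply']
    simp only [shift, ih]; congr 1; push_cast; ring

lemma randComp_add {m : ℕ} (T : Fin m → ℝ → ℝ) (ω : Om m) (k n : ℕ) :
    randComp T ω (k + n) = fun x => randComp T (shift^[k] ω) n (randComp T ω k x) := by
  induction n with
  | zero => rfl
  | succ n ih =>
    funext x
    change T (ω ((k + n : ℕ) : ℤ)) (randComp T ω (k + n) x) = T _ _
    rw [ih, shift_iterate_apply]; push_cast; rw [add_comm (n : ℤ)]

lemma sing_add {m : ℕ} (T : Fin m → ℝ → ℝ) (R : Fin m → Set ℝ) (ω : Om m) (k n : ℕ)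
    (hm : MapsTo (randComp T ω k) (Icc 0 1) (Icc 0 1)) :
    Sing T R ω (k + n) ⊆ Sing T R ω k ∪
      {x | x ∈ Icc (0:ℝ) 1 \ Sing T R ω k ∧ randComp T ω k x ∈ Sing T R (shift^[k] ω) n} := by
  induction n with
  | zero => exact subset_union_left
  | succ n ih =>
    rintro x (hx | ⟨hx, hx'⟩)
    · rcases ih hx with h | ⟨h, h'⟩
      · exact Or.inl h
      · exact Or.inr ⟨h, Or.inl h'⟩
    · by_cases hk : x ∈ Sing T R ω k
      · exact Or.inl hk
      refine Or.inr ⟨⟨hx.1, hk⟩, ?_⟩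
      by_cases hs : randComp T ω k x ∈ Sing T R (shift^[k] ω) n
      · exact Or.inl hs
      · refine Or.inr ⟨⟨hm hx.1, hs⟩, ?_⟩
        have hx2 : randComp T ω (k + n) x ∈ R (ω ((k + n : ℕ) : ℤ)) := hx'
        rw [randComp_add] at hx2
        rw [shift_iterate_apply, add_comm (n : ℤ)]
        exact_mod_cast hx2

lemma range_finite {m : ℕ} (T : Fin m → ℝ → ℝ) (R : Fin m → Set ℝ) (k : ℕ) :
    (range fun ω : Om m => (randComp T ω k, Sing T R ω k)).Finite := by
  induction k with
  | zero =>
    exact (finite_singleton ((fun x : ℝ => x), ({0, 1} : Set ℝ))).subset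
      (by rintro _ ⟨ω, rfl⟩; rfl)
  | succ k ih =>
    refine ((finite_univ (α := Fin m)).image2 (fun i q => ((fun x => T i (q.1 x)),
      q.2 ∪ {x | x ∈ Icc (0:ℝ) 1 \ q.2 ∧ q.1 x ∈ R i})) ih).subset ?_
    rintro _ ⟨ω, rfl⟩
    exact ⟨ω k, mem_univ _, _, ⟨ω, rfl⟩, rfl⟩

lemma split_interval (F : Set ℝ) (hF : F.Finite) (n : ℕ) : ∀ (u v : ℝ), u < v →
    (F ∩ Ioo u v).ncard ≤ n →
    ∃ (κ : Type) (_ : Fintype κ) (a b : κ → ℝ), Fintype.card κ ≤ n + 1 ∧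
      (∀ j, a j < b j ∧ Ioo (a j) (b j) ⊆ Ioo u v \ F) ∧
      ∑ j, (b j - a j) ≤ v - u ∧ (Ioo u v \ ⋃ j, Ioo (a j) (b j)).Finite := by
  induction n using Nat.strong_induction_on with
  | _ n ih =>
  intro u v huv hn
  by_cases he : F ∩ Ioo u v = ∅
  · refine ⟨Unit, inferInstance, fun _ => u, fun _ => v, by simp, ?_, by simp,
      by simp [iUnion_const]⟩
    intro _
    refine ⟨huv, fun x hx => ⟨hx, fun hxF => ?_⟩⟩
    have : x ∈ F ∩ Ioo u v := ⟨hxF, hx⟩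
    rw [he] at this; exact this
  obtain ⟨p, hpF, hp⟩ := nonempty_iff_ne_empty.mpr he
  have hc : (F ∩ Ioo u p).ncard + (F ∩ Ioo p v).ncard + 1 ≤ (F ∩ Ioo u v).ncard := by
    have f1 : (F ∩ Ioo u p).Finite := hF.inter_of_left _
    have f2 : (F ∩ Ioo p v).Finite := hF.inter_of_left _
    rw [← ncard_union_eq _ f1 f2, ← ncard_insert_of_notMem (a := p) _ (f1.union f2)]
    · apply ncard_le_ncard _ (hF.inter_of_left _)
      rintro x (rfl | ⟨hx, hx'⟩ | ⟨hx, hx'⟩)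
      · exact ⟨hpF, hp⟩
      · exact ⟨hx, hx'.1, hx'.2.trans hp.2⟩
      · exact ⟨hx, hp.1.trans hx'.1, hx'.2⟩
    · rintro (⟨_, hx'⟩ | ⟨_, hx'⟩)
      · exact lt_irrefl _ hx'.2
      · exact lt_irrefl _ hx'.1
    · rw [Set.disjoint_left]
      rintro x ⟨_, hx⟩ ⟨_, hx'⟩
      exact lt_asymm hx.2 hx'.1
  obtain ⟨κ₁, i₁, a₁, b₁, c₁, s₁, l₁, t₁⟩ := ih (F ∩ Ioo u p).ncard (by omega) u p hp.1 le_rfl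
  obtain ⟨κ₂, i₂, a₂, b₂, c₂, s₂, l₂, t₂⟩ := ih (F ∩ Ioo p v).ncard (by omega) p v hp.2 le_rfl
  refine ⟨κ₁ ⊕ κ₂, inferInstance, Sum.elim a₁ a₂, Sum.elim b₁ b₂, ?_, ?_, ?_, ?_⟩
  · rw [Fintype.card_sum]; omega
  · rintro (j | j)
    · refine ⟨(s₁ j).1, fun x hx => ?_⟩
      have := (s₁ j).2 hx
      exact ⟨⟨this.1.1, this.1.2.trans hp.2⟩, this.2⟩
    · refine ⟨(s₂ j).1, fun x hx => ?_⟩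
      have := (s₂ j).2 hx
      exact ⟨⟨hp.1.trans this.1.1, this.1.2⟩, this.2⟩
  · rw [Fintype.sum_sum_type]; simp only [Sum.elim_inl, Sum.elim_inr]; linarith
  · refine ((t₁.union t₂).union (finite_singleton p)).subset ?_
    rintro x ⟨hx, hx'⟩
    simp only [mem_iUnion, Sum.exists, Sum.elim_inl, Sum.elim_inr, not_or] at hx'
    rcases lt_trichotomy x p with h | h | h
    · exact Or.inl (Or.inl ⟨⟨hx.1, h⟩, by simpa using hx'.1⟩)
    · exact Or.inr h
    · exact Or.inl (Or.inr ⟨⟨h, hx.2⟩, by simpa using hx'.2⟩)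

/-- Finite cover by branches with controlled inverse expansion. -/
def Good (h : ℝ → ℝ) (S : Set ℝ) (Z : ℝ) : Prop :=
  ∃ (ι : Type) (_ : Fintype ι) (u v D : ι → ℝ),
    (∀ j, u j < v j ∧ Ioo (u j) (v j) ⊆ Icc 0 1 \ S ∧ 0 < D j ∧
      ∀ x ∈ Ioo (u j) (v j), D j ≤ |deriv h x|) ∧
    ∑ j, (v j - u j) ≤ 1 ∧ (Icc 0 1 \ ⋃ j, Ioo (u j) (v j)).Finite ∧
    ∑ j, (D j)⁻¹ ≤ Z

lemma Good.mono {h : ℝ → ℝ} {S : Set ℝ} {Z Z' : ℝ} (hZ : Z ≤ Z') (hg : Good h S Z) :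
    Good h S Z' := by
  obtain ⟨ι, i, u, v, D, h1, h2, h3, h4⟩ := hg
  exact ⟨ι, i, u, v, D, h1, h2, h3, h4.trans hZ⟩

lemma piece_split {h : ℝ → ℝ} {c D0 Λ δ : ℝ} {M : ℕ} {S R : Set ℝ} (hc : 0 ≤ c)
    (hΛ : 0 < Λ) (hδ : 0 < δ)
    (hh : NB h D0 S) (dh : Dst h c S) (hR : R.Finite)
    (hRM : R.ncard ≤ M) (hRδ : ∀ x ∈ R, ∀ y ∈ R, x ≠ y → δ ≤ |x - y|)
    (u v D : ℝ) (huv : u < v) (hA : Ioo u v ⊆ Icc 0 1 \ S) (hD : 0 < D)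
    (hDd : ∀ x ∈ Ioo u v, D ≤ |deriv h x|) :
    ∃ (κ : Type) (_ : Fintype κ) (a b : κ → ℝ) (E : κ → ℝ),
      (∀ j, a j < b j ∧ Ioo (a j) (b j) ⊆ Ioo u v \ {x | x ∈ Icc (0:ℝ) 1 \ S ∧ h x ∈ R} ∧
        0 < E j ∧ ∀ x ∈ Ioo (a j) (b j), E j ≤ |deriv h x|) ∧
      ∑ j, (b j - a j) ≤ v - u ∧ (Ioo u v \ ⋃ j, Ioo (a j) (b j)).Finite ∧
      ∑ j, (Λ * E j)⁻¹ ≤ 2 / Λ * D⁻¹ + (M + 1) * Real.exp c / (δ * Λ) * (v - u) := by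
  have hsub : ∀ x ∈ Ioo u v, ∀ y ∈ Ioo u v, uIcc x y ⊆ Ioo u v := by
    intro x hx y hy
    exact (ordConnected_Ioo (a := u) (b := v)).uIcc_subset hx hy
  have hinj : InjOn h (Ioo u v) := by
    intro x hx y hy e
    have := expand_of (h := h) (D := D)
      (fun z hz => hh.diff z (hA (hsub x hx y hy hz)))
      (fun z hz => hDd z (hsub x hx y hy hz))
    rw [e, sub_self, abs_zero] at this
    have h0 : |x - y| = 0 := le_antisymm (by nlinarith [abs_nonneg (x - y)]) (abs_nonneg _)
    linarith [abs_eq_zero.mp h0]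
  have hFf : {x | x ∈ Icc (0:ℝ) 1 \ S ∧ h x ∈ R}.Finite := by
    refine (hR.biUnion (fun y _ => hh.fto y)).subset ?_
    rintro x ⟨hx, hx'⟩
    simp only [mem_iUnion]
    exact ⟨h x, hx', hx, rfl⟩
  set F := {x | x ∈ Icc (0:ℝ) 1 \ S ∧ h x ∈ R} with hFdef
  have hvu : 0 < v - u := by linarith
  have fin : ∀ (n : ℕ) (E : ℝ), (F ∩ Ioo u v).ncard ≤ n → 0 < E →
      (∀ x ∈ Ioo u v, E ≤ |deriv h x|) →
      (n + 1) * (Λ * E)⁻¹ ≤ 2 / Λ * D⁻¹ + (M + 1) * Real.exp c / (δ * Λ) * (v - u) →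
      ∃ (κ : Type) (_ : Fintype κ) (a b : κ → ℝ) (E : κ → ℝ),
      (∀ j, a j < b j ∧ Ioo (a j) (b j) ⊆ Ioo u v \ F ∧
        0 < E j ∧ ∀ x ∈ Ioo (a j) (b j), E j ≤ |deriv h x|) ∧
      ∑ j, (b j - a j) ≤ v - u ∧ (Ioo u v \ ⋃ j, Ioo (a j) (b j)).Finite ∧
      ∑ j, (Λ * E j)⁻¹ ≤ 2 / Λ * D⁻¹ + (M + 1) * Real.exp c / (δ * Λ) * (v - u) := by
    intro n E hn hE hEd hle
    obtain ⟨κ, i, a, b, hκ, hs, hl, ht⟩ := split_interval F hFf n u v huv hn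
    refine ⟨κ, i, a, b, fun _ => E, fun j => ⟨(hs j).1, (hs j).2, hE,
      fun x hx => hEd x ((hs j).2 hx).1⟩, hl, ht, le_trans ?_ hle⟩
    simp only [Finset.sum_const, Finset.card_univ, nsmul_eq_mul]
    gcongr
    exact_mod_cast hκ
  by_cases hlong : ∃ x ∈ Ioo u v, ∃ y ∈ Ioo u v, δ ≤ |h x - h y|
  · obtain ⟨x, hx, y, hy, hxy⟩ := hlong
    have hxyI := hsub x hx y hy
    obtain ⟨z, hz, e⟩ := mvt_abs h x y (fun z hz => hh.diff z (hA (hxyI hz)))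
    have hzI := hxyI hz
    have hz0 : 0 < |deriv h z| := hD.trans_le (hDd z hzI)
    have hxyv : |x - y| ≤ v - u := by
      rw [abs_le]; constructor <;> linarith [hx.1, hx.2, hy.1, hy.2]
    have hzδ : δ / (v - u) ≤ |deriv h z| := by
      rw [div_le_iff₀ hvu]
      calc δ ≤ _ := hxy
        _ = _ := e
        _ ≤ _ := by gcongr
    refine fin M (Real.exp (-c) * (δ / (v - u))) ?_ (by positivity) ?_ ?_
    · refine le_trans ?_ hRM
      refine ncard_le_ncard_of_injOn h ?_ (hinj.mono inter_subset_right) hR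
      rintro t ⟨ht, _⟩; exact ht.2
    · intro t ht
      have ht0 : 0 < |deriv h t| := hD.trans_le (hDd t ht)
      have htI := hsub t ht z hzI
      have h1 := dh t z (fun s hs => hA (htI hs))
      have h2 : |h t - h z| ≤ 1 := by
        have := hh.maps (hA ht).1
        have := hh.maps (hA hzI).1
        rw [abs_le]; constructor <;> linarith [this.1, this.2, (hh.maps (hA ht).1).1, (hh.maps (hA ht).1).2]
      have h3 : ld h z - c ≤ ld h t := by
        have := (abs_le.mp h1).1
        nlinarith
      calc Real.exp (-c) * (δ / (v - u)) ≤ Real.exp (-c) * |deriv h z| := by gcongr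
        _ = Real.exp (ld h z - c) := by
          unfold ld
          rw [sub_eq_add_neg, Real.exp_add, Real.exp_log hz0, mul_comm]
        _ ≤ Real.exp (ld h t) := Real.exp_le_exp.mpr h3
        _ = _ := Real.exp_log ht0
    · have : ((M:ℝ) + 1) * (Λ * (Real.exp (-c) * (δ / (v - u))))⁻¹
          = (M + 1) * Real.exp c / (δ * Λ) * (v - u) := by
        rw [Real.exp_neg]; field_simp
      rw [this]
      have : 0 ≤ 2 / Λ * D⁻¹ := by positivity
      linarith
  · push Not at hlong
    refine fin 1 D ?_ hD hDd ?_
    · rw [ncard_le_one (hFf.inter_of_left _)]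
      intro x hx y hy
      by_contra hne
      have h1 := hRδ _ hx.1.2 _ hy.1.2 (fun e => hne (hinj hx.2 hy.2 e))
      exact absurd (hlong x hx.2 y hy.2) (not_lt.mpr h1)
    · have : ((1:ℕ) + 1 : ℝ) * (Λ * D)⁻¹ = 2 / Λ * D⁻¹ := by
        rw [mul_inv]; push_cast; ring
      rw [this]
      have : 0 ≤ (M + 1) * Real.exp c / (δ * Λ) * (v - u) := by positivity
      linarith

lemma Good.step {h g : ℝ → ℝ} {c D0 Λ δ Z : ℝ} {M : ℕ} {S R : Set ℝ} (hc : 0 ≤ c)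
    (hΛ : 0 < Λ) (hδ : 0 < δ)
    (hh : NB h D0 S) (dh : Dst h c S) (hg : NB g Λ R)
    (hRM : R.ncard ≤ M) (hRδ : ∀ x ∈ R, ∀ y ∈ R, x ≠ y → δ ≤ |x - y|)
    (hG : Good h S Z) :
    Good (fun x => g (h x)) (S ∪ {x | x ∈ Icc (0:ℝ) 1 \ S ∧ h x ∈ R})
      (2 / Λ * Z + (M + 1) * Real.exp c / (δ * Λ)) := by
  obtain ⟨ι, i, u, v, D, h1, h2, h3, h4⟩ := hG
  choose κ iκ a b E e1 e2 e3 e4 using fun j => piece_split hc hΛ hδ hh dh hg.fin hRM hRδ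
    (u j) (v j) (D j) (h1 j).1 (h1 j).2.1 (h1 j).2.2.1 (h1 j).2.2.2
  refine ⟨Σ j, κ j, inferInstance, fun q => a q.1 q.2, fun q => b q.1 q.2,
    fun q => Λ * E q.1 q.2, ?_, ?_, ?_, ?_⟩
  · rintro ⟨j, q⟩
    obtain ⟨f1, f2, f3, f4⟩ := e1 j q
    refine ⟨f1, ?_, by positivity, ?_⟩
    · intro x hx
      have hx1 := f2 hx
      have hx2 := (h1 j).2.1 hx1.1
      exact ⟨hx2.1, fun hor => hor.elim hx2.2 hx1.2⟩
    · intro x hx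
      have hx1 := f2 hx
      have hx2 := (h1 j).2.1 hx1.1
      have hx3 : h x ∈ Icc (0:ℝ) 1 \ R := ⟨hh.maps hx2.1, fun hr => hx1.2 ⟨hx2, hr⟩⟩
      have : deriv (fun x => g (h x)) x = deriv g (h x) * deriv h x :=
        deriv_comp x (hg.diff _ hx3) (hh.diff _ hx2)
      rw [this, abs_mul]
      exact mul_le_mul (hg.exp _ hx3) (f4 x hx) f3.le (abs_nonneg _)
  · rw [Fintype.sum_sigma]
    exact (Finset.sum_le_sum fun j _ => e2 j).trans h2
  · refine (h3.union (finite_iUnion fun j => e3 j)).subset ?_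
    rintro x ⟨hx, hx'⟩
    by_cases hxj : x ∈ ⋃ j, Ioo (u j) (v j)
    · right
      obtain ⟨j, hj⟩ := mem_iUnion.mp hxj
      refine mem_iUnion.mpr ⟨j, hj, fun hq => hx' ?_⟩
      obtain ⟨q, hq⟩ := mem_iUnion.mp hq
      exact mem_iUnion.mpr ⟨⟨j, q⟩, hq⟩
    · exact Or.inl ⟨hx, hxj⟩
  · rw [Fintype.sum_sigma]
    refine (Finset.sum_le_sum fun j _ => e4 j).trans ?_
    rw [Finset.sum_add_distrib, ← Finset.mul_sum, ← Finset.mul_sum]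
    have hK : 0 ≤ (M + 1) * Real.exp c / (δ * Λ) := by positivity
    have hK2 : 0 ≤ 2 / Λ := by positivity
    nlinarith

lemma Good.id : Good (fun x => x) {0, 1} 1 := by
  refine ⟨Unit, inferInstance, fun _ => 0, fun _ => 1, fun _ => 1, ?_, by simp, ?_, by simp⟩
  · intro _
    refine ⟨by norm_num, ?_, by norm_num, ?_⟩
    · intro x hx
      refine ⟨Ioo_subset_Icc_self hx, ?_⟩
      rintro (rfl | rfl)
      · exact lt_irrefl _ hx.1
      · exact lt_irrefl _ hx.2
    · intro x _; simp
  · refine (toFinite {(0:ℝ), 1}).subset ?_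
    rintro x ⟨hx, hx'⟩
    simp only [mem_iUnion, not_exists, mem_Ioo, not_and, not_lt] at hx'
    have := hx' ()
    rcases hx.1.eq_or_lt with h | h
    · left; exact h.symm
    · right; exact le_antisymm hx.2 (this h)

/-- Measure estimate for near-fixed points from a good cover. -/
lemma Good.measure {h : ℝ → ℝ} {S : Set ℝ} {D0 Z lam ε : ℝ} (hlam : 1 < lam) (hD0 : lam ≤ D0)
    (hh : NB h D0 S) (hG : Good h S Z) (hε : 0 ≤ ε) :
    mLeb {x | |h x - x| < ε} ≤ ENNReal.ofReal (2 * ε * (lam / (lam - 1)) * Z) := by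
  obtain ⟨ι, i, u, v, D, h1, h2, h3, h4⟩ := hG
  have hsub : ({x | |h x - x| < ε} ∩ Icc 0 1) ⊆ (Icc 0 1 \ ⋃ j, Ioo (u j) (v j)) ∪
      ⋃ j, (Ioo (u j) (v j) ∩ {x | |h x - x| < ε}) := by
    rintro x ⟨hx, hx'⟩
    by_cases hxj : x ∈ ⋃ j, Ioo (u j) (v j)
    · right
      obtain ⟨j, hj⟩ := mem_iUnion.mp hxj
      exact mem_iUnion.mpr ⟨j, hj, hx⟩
    · exact Or.inl ⟨hx', hxj⟩
  have hl : 0 < lam - 1 := by linarith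
  have hpiece : ∀ j, volume (Ioo (u j) (v j) ∩ {x | |h x - x| < ε}) ≤
      ENNReal.ofReal (2 * ε * (lam / (lam - 1)) * (D j)⁻¹) := by
    intro j
    obtain ⟨f1, f2, f3, f4⟩ := h1 j
    refine (Real.volume_le_diam _).trans ?_
    refine Metric.ediam_le ?_
    rintro x ⟨hx, hx'⟩ y ⟨hy, hy'⟩
    rw [edist_dist]
    apply ENNReal.ofReal_le_ofReal
    rw [Real.dist_eq]
    have hI : uIcc x y ⊆ Ioo (u j) (v j) :=
      (ordConnected_Ioo (a := u j) (b := v j)).uIcc_subset hx hy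
    have g1 := expand_of (h := h) (D := D j) (fun z hz => hh.diff z (f2 (hI hz)))
      (fun z hz => f4 z (hI hz))
    have g2 := expand_of (h := h) (D := lam) (fun z hz => hh.diff z (f2 (hI hz)))
      (fun z hz => hD0.trans (hh.exp z (f2 (hI hz))))
    have g3 : |h x - h y| ≤ |x - y| + 2 * ε := by
      have e : h x - h y = (h x - x) + (x - y) - (h y - y) := by ring
      have a1 := abs_sub (h x - x + (x - y)) (h y - y)
      have a2 := abs_add_le (h x - x) (x - y)
      simp only [mem_ofPred_eq] at hx' hy'
      rw [e]; linarith
    rw [← div_eq_mul_inv, le_div_iff₀ f3]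
    have g4 : |x - y| ≤ 2 * ε / (lam - 1) := by
      rw [le_div_iff₀ hl]; nlinarith
    have e : 2 * ε * (lam / (lam - 1)) = 2 * ε / (lam - 1) + 2 * ε := by
      field_simp; ring
    rw [e]; linarith
  unfold mLeb
  rw [Measure.restrict_apply' measurableSet_Icc]
  calc _ ≤ volume _ := measure_mono hsub
    _ ≤ volume (Icc 0 1 \ ⋃ j, Ioo (u j) (v j))
        + volume (⋃ j, (Ioo (u j) (v j) ∩ {x | |h x - x| < ε})) := measure_union_le _ _
    _ = volume (⋃ j, (Ioo (u j) (v j) ∩ {x | |h x - x| < ε})) := by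
        rw [h3.measure_zero, zero_add]
    _ ≤ ∑ j, volume (Ioo (u j) (v j) ∩ {x | |h x - x| < ε}) := measure_iUnion_fintype_le _ _
    _ ≤ ∑ j, ENNReal.ofReal (2 * ε * (lam / (lam - 1)) * (D j)⁻¹) :=
        Finset.sum_le_sum fun j _ => hpiece j
    _ = ENNReal.ofReal (∑ j, 2 * ε * (lam / (lam - 1)) * (D j)⁻¹) := by
        rw [ENNReal.ofReal_sum_of_nonneg]
        intro j _
        have := (h1 j).2.2.1
        positivity
    _ ≤ _ := by
        apply ENNReal.ofReal_le_ofReal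
        rw [← Finset.mul_sum]
        gcongr

lemma sep_of_finite (S : Set ℝ) (hS : S.Finite) :
    ∃ δ > 0, ∀ x ∈ S, ∀ y ∈ S, x ≠ y → δ ≤ |x - y| := by
  have hf : (Set.image (fun q : ℝ × ℝ => |q.1 - q.2|) ((S ×ˢ S) ∩ {q | q.1 ≠ q.2})).Finite :=
    ((hS.prod hS).inter_of_left _).image _
  have hpos : ∀ t ∈ insert (1:ℝ) (Set.image (fun q : ℝ × ℝ => |q.1 - q.2|)
      ((S ×ˢ S) ∩ {q | q.1 ≠ q.2})), 0 < t := by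
    rintro t (rfl | ⟨q, ⟨_, hq⟩, rfl⟩)
    · norm_num
    · exact abs_pos.mpr (sub_ne_zero.mpr hq)
  obtain ⟨δ, hδ, hmin⟩ := Set.exists_min_image _ (fun t : ℝ => t) (hf.insert 1) ⟨1, Or.inl rfl⟩
  refine ⟨δ, hpos δ hδ, fun x hx y hy hne => hmin _ (Or.inr ⟨(x, y), ⟨⟨hx, hy⟩, hne⟩, rfl⟩)⟩

lemma uniform_blocks {m : ℕ} (T : Fin m → ℝ → ℝ) (R : Fin m → Set ℝ)
    (hfin : ∀ (ω : Om m) s, (Sing T R ω s).Finite) (N : ℕ) :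
    ∃ (M : ℕ) (δ : ℝ), 0 < δ ∧ ∀ ω : Om m, ∀ s ≤ N, (Sing T R ω s).ncard ≤ M ∧
      ∀ x ∈ Sing T R ω s, ∀ y ∈ Sing T R ω s, x ≠ y → δ ≤ |x - y| := by
  have key : ∀ (F : Set (Set ℝ)), F.Finite →
      (∀ S ∈ F, S.Finite) → ∃ (M : ℕ) (δ : ℝ), 0 < δ ∧ ∀ S ∈ F,
        S.ncard ≤ M ∧ ∀ x ∈ S, ∀ y ∈ S, x ≠ y → δ ≤ |x - y| := by
    intro F hF
    induction F, hF using Set.Finite.induction_on with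
    | empty => intro _; exact ⟨0, 1, one_pos, by simp⟩
    | @insert f F _ _ ih =>
      intro hall
      obtain ⟨M, δ, hδ, h⟩ := ih (fun g hg => hall g (Or.inr hg))
      obtain ⟨δ', hδ', h'⟩ := sep_of_finite f (hall f (Or.inl rfl))
      refine ⟨max M f.ncard, min δ δ', lt_min hδ hδ', ?_⟩
      rintro g (rfl | hg)
      · exact ⟨le_max_right _ _, fun x hx y hy hne =>
          (min_le_right _ _).trans (h' x hx y hy hne)⟩
      · obtain ⟨h2, h3⟩ := h g hg
        exact ⟨h2.trans (le_max_left _ _), fun x hx y hy hne =>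
          (min_le_left _ _).trans (h3 x hx y hy hne)⟩
  obtain ⟨M, δ, hδ, h⟩ := key (⋃ s ∈ Iic N, range fun ω : Om m => Sing T R ω s)
    ((finite_Iic N).biUnion fun s _ => by
      have := (range_finite T R s).image Prod.snd
      rwa [← range_comp] at this)
    (by
      intro S hS
      simp only [mem_iUnion, mem_range] at hS
      obtain ⟨s, _, ω, rfl⟩ := hS
      exact hfin ω s)
  refine ⟨M, δ, hδ, fun ω s hs => h _ ?_⟩
  simp only [mem_iUnion, mem_range]
  exact ⟨s, hs, ω, rfl⟩

lemma Dst.mono {h : ℝ → ℝ} {c : ℝ} {S S' : Set ℝ} (dh : Dst h c S) (hs : S ⊆ S') :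
    Dst h c S' := by
  intro x y hxy
  exact dh x y (fun t ht => ⟨(hxy ht).1, fun hh => (hxy ht).2 (hs hh)⟩)

lemma uniform_good {m : ℕ} (T : Fin m → ℝ → ℝ) (lam L : ℝ) (hlam : 1 < lam)
    (hL : 0 ≤ L) (hT : ∀ i, ∃ R, NB (T i) lam R ∧ LipLog (T i) L R) :
    ∃ Z, 0 ≤ Z ∧ ∀ (ω : Om m) (k : ℕ), ∃ S, NB (randComp T ω k) (lam ^ k) S ∧
      Good (randComp T ω k) S Z := by
  set c := L / (lam - 1) with hc
  have hc0 : 0 ≤ c := div_nonneg hL (by linarith)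
  choose R hR using hT
  have nice := sing_nice T R lam L c hlam hL hc hR
  obtain ⟨N, hN⟩ := pow_unbounded_of_one_lt 2 hlam
  have hN0 : N ≠ 0 := by rintro rfl; norm_num at hN
  obtain ⟨M, δ, hδ, hblk⟩ := uniform_blocks T R (fun ω s => (nice ω s).1.fin) N
  set θ := 2 / lam ^ N with hθ
  have hθ1 : θ < 1 := by rw [hθ, div_lt_one (by positivity)]; exact hN
  have hθ0 : 0 ≤ θ := by positivity
  set K := (M + 1) * Real.exp c / δ with hK
  have hK0 : 0 ≤ K := by positivity
  have hKs : ∀ s : ℕ, (M + 1) * Real.exp c / (δ * lam ^ s) ≤ K := by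
    intro s
    rw [hK]
    have : 1 ≤ lam ^ s := one_le_pow₀ hlam.le
    gcongr
    nlinarith
  set Z := 2 + K + K / (1 - θ) with hZ
  have h1θ : 0 < 1 - θ := by linarith
  have hKθ : 0 ≤ K / (1 - θ) := by positivity
  have hZ0 : 0 ≤ Z := by positivity
  have hZstep : θ * Z + K ≤ Z := by
    have : K / (1 - θ) * (1 - θ) = K := by field_simp
    nlinarith
  refine ⟨Z, hZ0, fun ω k => ?_⟩
  suffices H : ∃ S, Sing T R ω k ⊆ S ∧ NB (randComp T ω k) (lam ^ k) S ∧
      Good (randComp T ω k) S Z by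
    obtain ⟨S, _, h⟩ := H; exact ⟨S, h⟩
  induction k using Nat.strong_induction_on with
  | _ k ih =>
  rcases Nat.lt_or_ge k N with hk | hk
  · obtain ⟨b1, b2⟩ := hblk ω k hk.le
    have d0 : Dst (fun x => x) c {0, 1} := (nice ω 0).2
    have G := Good.step (Λ := lam ^ k) hc0 (by positivity) hδ NB.id d0 (nice ω k).1 b1 b2 Good.id
    have B := NB.comp zero_le_one NB.id (nice ω k).1
    rw [mul_one] at B
    refine ⟨_, ?_, B, G.mono ?_⟩
    · have := sing_add T R ω 0 k (nice ω 0).1.maps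
      rw [zero_add] at this
      exact this
    · have h1 : 2 / lam ^ k ≤ 2 := div_le_self (by norm_num) (one_le_pow₀ hlam.le)
      linarith [hKs k]
  · obtain ⟨S, s1, s2, s3⟩ := ih (k - N) (by omega)
    obtain ⟨b1, b2⟩ := hblk (shift^[k - N] ω) N le_rfl
    have d0 := (nice ω (k - N)).2.mono s1
    have n1 := (nice (shift^[k - N] ω) N).1
    have G := Good.step (Λ := lam ^ N) hc0 (by positivity) hδ s2 d0 n1 b1 b2 s3
    have B := NB.comp (by positivity) s2 n1
    have e := randComp_add T ω (k - N) N
    have ek : k - N + N = k := by omega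
    rw [ek] at e
    rw [← pow_add, add_comm N, ek, ← e] at B
    rw [← e] at G
    refine ⟨_, ?_, B, G.mono ?_⟩
    · have := sing_add T R ω (k - N) N s2.maps
      rw [ek] at this
      refine this.trans ?_
      rintro x (hx | ⟨hx, hx'⟩)
      · exact Or.inl (s1 hx)
      · by_cases hxS : x ∈ S
        · exact Or.inl hxS
        · exact Or.inr ⟨⟨hx.1, hxS⟩, hx'⟩
    · linarith [hKs N]

lemma near_fixed {m : ℕ} (T : Fin m → ℝ → ℝ) (lam L : ℝ) (hlam : 1 < lam)
    (hL : 0 ≤ L) (hT : ∀ i, ∃ R, NB (T i) lam R ∧ LipLog (T i) L R) :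
    ∃ C, 0 ≤ C ∧ ∀ (ω : Om m) (k : ℕ), 1 ≤ k → ∀ ε : ℝ, 0 ≤ ε →
      mLeb {x | |randComp T ω k x - x| < ε} ≤ ENNReal.ofReal (C * ε) := by
  obtain ⟨Z, hZ, h⟩ := uniform_good T lam L hlam hL hT
  have : 0 < lam - 1 := by linarith
  refine ⟨2 * (lam / (lam - 1)) * Z, by positivity, fun ω k hk ε hε => ?_⟩
  obtain ⟨S, h1, h2⟩ := h ω k
  refine (Good.measure hlam (le_self_pow₀ hlam.le (by omega)) h1 h2 hε).trans ?_
  apply ENNReal.ofReal_le_ofReal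
  apply le_of_eq; ring


lemma log_lip {s t : ℝ} (hs : 1 ≤ s) (ht : 1 ≤ t) :
    |Real.log s - Real.log t| ≤ |s - t| := by
  have key : ∀ s t : ℝ, 1 ≤ s → 1 ≤ t → Real.log s - Real.log t ≤ |s - t| := by
    intro s t hs ht
    rw [← Real.log_div (by linarith) (by linarith)]
    refine (Real.log_le_sub_one_of_pos (by positivity)).trans ?_
    have e : s / t - 1 = (s - t) / t := by field_simp
    rw [e]
    refine (div_le_div_of_nonneg_right (le_abs_self _) (by linarith)).trans ?_
    exact div_le_self (abs_nonneg _) ht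
  rw [abs_le]
  have h1 := key s t hs ht
  have h2 := key t s ht hs
  rw [abs_sub_comm] at h2
  constructor <;> linarith

lemma single_piece (g : ℝ → ℝ) (a b lam : ℝ) (hab : a < b) (hlam : 1 < lam)
    (hg : ContDiffOn ℝ 2 g (Icc a b))
    (he : ∀ x ∈ Icc a b, lam ≤ |derivWithin g (Icc a b) x|) :
    ∃ L, 0 ≤ L ∧ ∀ x ∈ Icc a b, ∀ y ∈ Icc a b,
      |Real.log (|derivWithin g (Icc a b) x|) - Real.log (|derivWithin g (Icc a b) y|)|
        ≤ L * |x - y| := by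
  have h1 : ContDiffOn ℝ 1 (derivWithin g (Icc a b)) (Icc a b) :=
    hg.derivWithin (uniqueDiffOn_Icc hab) (by norm_num)
  obtain ⟨K, hK⟩ := h1.exists_lipschitzOnWith (by norm_num) (convex_Icc _ _) isCompact_Icc
  refine ⟨K, K.2, fun x hx y hy => ?_⟩
  have hd := hK.dist_le_mul x hx y hy
  rw [Real.dist_eq, Real.dist_eq] at hd
  refine le_trans ?_ hd
  refine (log_lip (hlam.le.trans (he x hx)) (hlam.le.trans (he y hy))).trans ?_
  exact abs_abs_sub_abs_le _ _

lemma nice_of_piecewise (T : ℝ → ℝ) (lam : ℝ) (hlam : 1 < lam) (hT : PiecewiseC2Expanding T lam)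
    (hmaps : MapsTo T (Icc 0 1) (Icc 0 1)) :
    ∃ L, 0 ≤ L ∧ ∃ R, NB T lam R ∧ LipLog T L R := by
  obtain ⟨N, a, hN, a0, aN, ha, hpc⟩ := hT
  choose! g g1 g2 g3 g4 using hpc
  have hL : ∀ i, ∃ L, 0 ≤ L ∧ (i < N → ∀ x ∈ Icc (a i) (a (i + 1)), ∀ y ∈ Icc (a i) (a (i + 1)),
      |Real.log (|derivWithin (g i) (Icc (a i) (a (i + 1))) x|) -
        Real.log (|derivWithin (g i) (Icc (a i) (a (i + 1))) y|)| ≤ L * |x - y|) := by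
    intro i
    by_cases hi : i < N
    · obtain ⟨L, h0, h⟩ := single_piece (g i) (a i) (a (i + 1)) lam (ha i hi) hlam (g1 i hi) (g4 i hi)
      exact ⟨L, h0, fun _ => h⟩
    · exact ⟨0, le_rfl, fun h => absurd h hi⟩
  choose L L0 hL using hL
  have hfind : ∀ n ≤ N, ∀ x ∈ Icc (0:ℝ) 1 \ (Set.image a (Iic N)), x < a n →
      ∃ i < N, x ∈ Ioo (a i) (a (i + 1)) := by
    intro n
    induction n with
    | zero => intro _ x hx h; rw [a0] at h; exact absurd hx.1.1 (not_le.mpr h)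
    | succ n ih =>
      intro hn x hx h
      rcases lt_trichotomy x (a n) with h1 | h1 | h1
      · exact ih (by omega) x hx h1
      · exact absurd ⟨n, by simp; omega, h1.symm⟩ hx.2
      · exact ⟨n, by omega, h1, h⟩
  have hpiece : ∀ x ∈ Icc (0:ℝ) 1 \ (Set.image a (Iic N)), ∃ i < N, x ∈ Ioo (a i) (a (i + 1)) := by
    intro x hx
    refine hfind N le_rfl x hx ?_
    rw [aN]
    refine lt_of_le_of_ne hx.1.2 fun e => hx.2 ⟨N, by simp, by rw [aN, e]⟩
  have hmono : ∀ j ≤ N, ∀ i ≤ j, a i ≤ a j := by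
    intro j
    induction j with
    | zero => intro _ i hi; obtain rfl : i = 0 := by omega
              exact le_rfl
    | succ j ih =>
      intro hj i hi
      rcases Nat.lt_or_ge i (j + 1) with h | h
      · exact (ih (by omega) i (by omega)).trans (ha j (by omega)).le
      · obtain rfl : i = j + 1 := by omega
        exact le_rfl
  have hder : ∀ i < N, ∀ x ∈ Ioo (a i) (a (i + 1)),
      HasDerivAt T (derivWithin (g i) (Icc (a i) (a (i + 1))) x) x := by
    intro i hi x hx
    have h1 : DifferentiableWithinAt ℝ (g i) (Icc (a i) (a (i + 1))) x :=
      ((g1 i hi).differentiableOn (by norm_num)) x (Ioo_subset_Icc_self hx)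
    have h2 := h1.hasDerivWithinAt.hasDerivAt (Icc_mem_nhds hx.1 hx.2)
    refine h2.congr_of_eventuallyEq ?_
    filter_upwards [Ioo_mem_nhds hx.1 hx.2] with t ht using g2 i hi ht
  refine ⟨∑ i ∈ Finset.range N, L i, Finset.sum_nonneg fun i _ => L0 i, Set.image a (Iic N), ?_, ?_⟩
  · refine ⟨(finite_Iic N).image a, ⟨0, by simp, a0⟩, ⟨N, by simp, aN⟩, hmaps, ?_, ?_, ?_⟩
    · intro y
      have : (⋃ i ∈ Iio N, {x | x ∈ Ioo (a i) (a (i + 1)) ∧ T x = y}).Finite := by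
        refine (finite_Iio N).biUnion fun i hi => Set.Subsingleton.finite ?_
        rintro x ⟨hx, hx'⟩ z ⟨hz, hz'⟩
        have inj : InjOn (g i) (Icc (a i) (a (i + 1))) :=
          (g3 i hi).elim StrictMonoOn.injOn StrictAntiOn.injOn
        refine inj (Ioo_subset_Icc_self hx) (Ioo_subset_Icc_self hz) ?_
        rw [← g2 i hi hx, ← g2 i hi hz, hx', hz']
      refine this.subset ?_
      rintro x ⟨hx, hx'⟩
      obtain ⟨i, hi, h⟩ := hpiece x hx
      simp only [mem_iUnion]
      exact ⟨i, hi, h, hx'⟩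
    · intro x hx
      obtain ⟨i, hi, h⟩ := hpiece x hx
      exact (hder i hi x h).differentiableAt
    · intro x hx
      obtain ⟨i, hi, h⟩ := hpiece x hx
      rw [(hder i hi x h).deriv]
      exact g4 i hi x (Ioo_subset_Icc_self h)
  · intro x y hxy
    obtain ⟨i, hi, h⟩ := hpiece x (hxy left_mem_uIcc)
    obtain ⟨j, hj, h'⟩ := hpiece y (hxy right_mem_uIcc)
    obtain rfl : i = j := by
      rcases lt_trichotomy i j with hij | hij | hij
      · have h1 := hmono j hj.le (i + 1) hij
        have : a j ∈ uIcc x y := by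
          rw [mem_uIcc]; left; exact ⟨(h.2.trans_le h1).le, h'.1.le⟩
        exact absurd ⟨j, hj.le, rfl⟩ (hxy this).2
      · exact hij
      · have h1 := hmono i hi.le (j + 1) hij
        have : a i ∈ uIcc x y := by
          rw [mem_uIcc]; right; exact ⟨(h'.2.trans_le h1).le, h.1.le⟩
        exact absurd ⟨i, hi.le, rfl⟩ (hxy this).2
    unfold ld
    rw [(hder i hi x h).deriv, (hder i hi y h').deriv]
    refine (hL i hi x (Ioo_subset_Icc_self h) y (Ioo_subset_Icc_self h')).trans ?_
    gcongr
    exact Finset.single_le_sum (fun i _ => L0 i) (Finset.mem_range.mpr hi)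

lemma all_nice {m : ℕ} (T : Fin m → ℝ → ℝ) (lam : ℝ) (hlam : 1 < lam)
    (hT : ∀ i, PiecewiseC2Expanding (T i) lam)
    (hmaps : ∀ i, MapsTo (T i) (Icc 0 1) (Icc 0 1)) :
    ∃ L, 0 ≤ L ∧ ∀ i, ∃ R, NB (T i) lam R ∧ LipLog (T i) L R := by
  choose L L0 R h1 h2 using fun i => nice_of_piecewise (T i) lam hlam (hT i) (hmaps i)
  refine ⟨∑ i, L i, Finset.sum_nonneg fun i _ => L0 i, fun i => ⟨R i, h1 i, fun x y hxy => ?_⟩⟩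
  refine (h2 i x y hxy).trans ?_
  gcongr
  exact Finset.single_le_sum (fun i _ => L0 i) (Finset.mem_univ i)

lemma indicator_measurable {T : ℝ → ℝ} {lam : ℝ} {R : Set ℝ} (h : NB T lam R) :
    Measurable ((Icc (0:ℝ) 1).indicator T) := by
  have hm : MeasurableSet (Icc (0:ℝ) 1 \ R) := measurableSet_Icc.diff h.fin.measurableSet
  have hc : ContinuousOn T (Icc (0:ℝ) 1 \ R) := fun x hx =>
    (h.diff x hx).continuousAt.continuousWithinAt
  classical
  have h1 : Measurable ((Icc (0:ℝ) 1 \ R).piecewise T (fun _ => 0)) :=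
    hc.measurable_piecewise continuousOn_const hm
  refine h1.measurable_of_countable_ne (h.fin.countable.mono ?_)
  intro x hx
  by_contra hxR
  apply hx
  by_cases hI : x ∈ Icc (0:ℝ) 1
  · have hIR : x ∈ Icc (0:ℝ) 1 \ R := ⟨hI, hxR⟩
    rw [piecewise_eq_of_mem _ _ _ hIR, indicator_of_mem hI]
  · rw [piecewise_eq_of_notMem _ _ _ (fun h => hI h.1), indicator_of_notMem hI]

lemma randComp_indicator {m : ℕ} (T : Fin m → ℝ → ℝ)
    (hmaps : ∀ i, MapsTo (T i) (Icc 0 1) (Icc 0 1)) (ω : Om m) (k : ℕ) :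
    ∀ x ∈ Icc (0:ℝ) 1, randComp T ω k x ∈ Icc (0:ℝ) 1 ∧
      randComp (fun i => (Icc (0:ℝ) 1).indicator (T i)) ω k x = randComp T ω k x := by
  intro x hx
  induction k with
  | zero => exact ⟨hx, rfl⟩
  | succ k ih =>
    refine ⟨hmaps _ ih.1, ?_⟩
    simp only [randComp]
    rw [ih.2, indicator_of_mem ih.1]

lemma randComp_measurable {m : ℕ} (T : Fin m → ℝ → ℝ) (hT : ∀ i, Measurable (T i)) (k : ℕ) :
    Measurable fun q : Om m × ℝ => randComp T q.1 k q.2 := by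
  have h2 : Measurable fun q : Fin m × ℝ => T q.1 q.2 :=
    measurable_from_prod_countable_right hT
  induction k with
  | zero => exact measurable_snd
  | succ k ih =>
    have h1 : Measurable fun q : Om m × ℝ => (q.1 (k : ℤ), randComp T q.1 k q.2) :=
      ((measurable_pi_apply _).comp measurable_fst).prodMk ih
    exact h2.comp h1

lemma shift_measurable {m : ℕ} (i : ℕ) : Measurable (shift^[i] : Om m → Om m) := by
  refine measurable_pi_lambda _ fun j => ?_
  simp only [shift_iterate_apply]
  exact measurable_pi_apply _

instance mLeb_finite : IsFiniteMeasure mLeb := by unfold mLeb; infer_instance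

/-- Measure of the points of the ball around `x0` which return at time `k`. -/
def Ret {m : ℕ} (T : Fin m → ℝ → ℝ) (i k : ℕ) (r : ℝ) (q : ℝ × Om m) : ENNReal :=
  mLeb {x | |x - q.1| < r ∧ |randComp T (shift^[i] q.2) k x - q.1| < r}

lemma Ret_measurable {m : ℕ} (T : Fin m → ℝ → ℝ) (hT : ∀ i, Measurable (T i)) (i k : ℕ) (r : ℝ) :
    Measurable (Ret T i k r) := by
  have h1 : Measurable fun z : (ℝ × Om m) × ℝ => |z.2 - z.1.1| := by fun_prop
  have h2 : Measurable fun z : (ℝ × Om m) × ℝ => randComp T (shift^[i] z.1.2) k z.2 :=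
    (randComp_measurable T hT k).comp
      (((shift_measurable i).comp (measurable_snd.comp measurable_fst)).prodMk measurable_snd)
  have h3 : Measurable fun z : (ℝ × Om m) × ℝ =>
      |randComp T (shift^[i] z.1.2) k z.2 - z.1.1| :=
    (h2.sub (measurable_fst.comp measurable_fst)).abs
  have hs : MeasurableSet {z : (ℝ × Om m) × ℝ |
      |z.2 - z.1.1| < r ∧ |randComp T (shift^[i] z.1.2) k z.2 - z.1.1| < r} :=
    (measurableSet_lt h1 measurable_const).inter (measurableSet_lt h3 measurable_const)
  exact measurable_measure_prodMk_left (ν := mLeb) hs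

lemma ret_int (h : ℝ → ℝ) (hm : Measurable h) (r : ℝ) :
    ∫⁻ x0, mLeb {x | |x - x0| < r ∧ |h x - x0| < r} ∂mLeb ≤
      ENNReal.ofReal (2 * r) * mLeb {x | |h x - x| < 2 * r} := by
  have hs : MeasurableSet {z : ℝ × ℝ | |z.2 - z.1| < r ∧ |h z.2 - z.1| < r} :=
    (measurableSet_lt (f := fun z : ℝ × ℝ => |z.2 - z.1|) (by fun_prop) measurable_const).inter
      (measurableSet_lt (f := fun z : ℝ × ℝ => |h z.2 - z.1|) (by fun_prop) measurable_const)
  have e1 := Measure.prod_apply (μ := mLeb) (ν := mLeb) hs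
  have e2 := Measure.prod_apply_symm (μ := mLeb) (ν := mLeb) hs
  have hms : MeasurableSet {x | |h x - x| < 2 * r} :=
    measurableSet_lt (by fun_prop) measurable_const
  calc _ = _ := e1.symm
    _ = _ := e2
    _ ≤ ∫⁻ x, {x | |h x - x| < 2 * r}.indicator (fun _ => ENNReal.ofReal (2 * r)) x ∂mLeb := by
        refine lintegral_mono fun x => ?_
        by_cases hx : x ∈ {x | |h x - x| < 2 * r}
        · rw [indicator_of_mem hx]
          calc _ ≤ volume _ := Measure.restrict_apply_le _ _
            _ ≤ volume (Metric.ball x r) := by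
              refine measure_mono fun t ht => ?_
              rw [Metric.mem_ball, dist_comm, Real.dist_eq]
              exact ht.1
            _ = _ := Real.volume_ball x r
        · rw [indicator_of_notMem hx]
          have : (fun t => (t, x)) ⁻¹' {z : ℝ × ℝ | |z.2 - z.1| < r ∧ |h z.2 - z.1| < r} = ∅ := by
            rw [eq_empty_iff_forall_notMem]
            rintro t ⟨h1, h2⟩
            apply hx
            change |h x - x| < 2 * r
            have e : h x - x = (h x - t) - (x - t) := by ring
            have := abs_sub (h x - t) (x - t)
            simp only at h1 h2
            rw [e]; linarith
          rw [this]; simp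
    _ = _ := by rw [lintegral_indicator_const hms]

lemma Ret_int {m : ℕ} (T : Fin m → ℝ → ℝ) (hT : ∀ i, Measurable (T i)) (P : Measure (Om m))
    [IsProbabilityMeasure P] (C : ℝ)
    (hnf : ∀ (ω : Om m) (k : ℕ), 1 ≤ k → ∀ ε : ℝ, 0 ≤ ε →
      mLeb {x | |randComp T ω k x - x| < ε} ≤ ENNReal.ofReal (C * ε))
    (i k : ℕ) (hk : 1 ≤ k) (r : ℝ) (hr : 0 ≤ r) :
    ∫⁻ q, Ret T i k r q ∂(mLeb.prod P) ≤ ENNReal.ofReal (4 * C * r ^ 2) := by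
  rw [lintegral_prod_symm _ (Ret_measurable T hT i k r).aemeasurable]
  calc _ ≤ ∫⁻ _ω : Om m, ENNReal.ofReal (4 * C * r ^ 2) ∂P := by
        refine lintegral_mono fun ω => ?_
        have hm : Measurable (randComp T (shift^[i] ω) k) :=
          (randComp_measurable T hT k).comp (measurable_const.prodMk measurable_id)
        refine (ret_int _ hm r).trans ?_
        refine (mul_le_mul_right (hnf (shift^[i] ω) k hk (2 * r) (by positivity)) _).trans ?_
        rw [← ENNReal.ofReal_mul (by positivity)]
        apply ENNReal.ofReal_le_ofReal
        apply le_of_eq; ring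
    _ = _ := by simp

theorem stmt9 (m : ℕ) (hm : 1 ≤ m) (T : Fin m → ℝ → ℝ) (lam : ℝ) (hlam : 1 < lam)
    (hT : ∀ i, PiecewiseC2Expanding (T i) lam)
    (hmaps : ∀ i, Set.MapsTo (T i) (Set.Icc 0 1) (Set.Icc 0 1))
    (p : Fin m → ℝ) (hp : ∀ i, 0 < p i) (hp1 : ∑ i, p i = 1)
    (P : Measure (Om m)) (hPprob : IsProbabilityMeasure P)
    -- `P` is the Bernoulli product measure `(p_1, …, p_m)^{⊗ℤ}`
    (hP : ∀ (s : Finset ℤ) (f : ℤ → Fin m),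
      P {ω | ∀ i ∈ s, ω i = f i} = ENNReal.ofReal (∏ i ∈ s, p (f i)))
    (a ψ : ℝ) (ha : 0 < a) (hψ1 : 3 / 4 < ψ) (hψ2 : ψ < 1) :
    ∀ᵐ x0 ∂mLeb, ∀ᵐ ω ∂P,
      Tendsto (fun n : ℕ => Real.log n * ∑ i ∈ Finset.range n,
        (mLeb (Metric.ball x0 ((n : ℝ) ^ (-ψ)) ∩
          hitWithin T (shift^[i] ω) (Metric.ball x0 ((n : ℝ) ^ (-ψ)))
            ⌊a * Real.log n⌋₊)).toReal)
        atTop (𝓝 0) := by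
  obtain ⟨L, L0, hnice⟩ := all_nice T lam hlam hT hmaps
  obtain ⟨C, C0, hnf⟩ := near_fixed T lam L hlam L0 hnice
  set T' : Fin m → ℝ → ℝ := fun i => (Icc (0:ℝ) 1).indicator (T i) with hT'
  have hT'm : ∀ i, Measurable (T' i) := fun i => by
    obtain ⟨R, hR, _⟩ := hnice i
    exact indicator_measurable hR
  have hcomp := randComp_indicator T hmaps
  have hnf' : ∀ (ω : Om m) (k : ℕ), 1 ≤ k → ∀ ε : ℝ, 0 ≤ ε →
      mLeb {x | |randComp T' ω k x - x| < ε} ≤ ENNReal.ofReal (C * ε) := by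
    intro ω k hk ε hε
    refine le_trans ?_ (hnf ω k hk ε hε)
    unfold mLeb
    rw [Measure.restrict_apply' measurableSet_Icc, Measure.restrict_apply' measurableSet_Icc]
    refine measure_mono ?_
    rintro x ⟨hx, hxI⟩
    refine ⟨?_, hxI⟩
    have := (hcomp ω k x hxI).2
    change |randComp T ω k x - x| < ε
    rw [← this]; exact hx
  set b : ℝ := (2:ℝ) ^ (-ψ) with hb
  have hb0 : 0 < b := by positivity
  have hb2 : 2 * b ^ 2 < 1 := by
    have : b ^ 2 = (2:ℝ) ^ (-(2 * ψ)) := by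
      rw [hb, ← Real.rpow_natCast, ← Real.rpow_mul (by norm_num)]; congr 1; push_cast; ring
    rw [this]
    have h2 : (2:ℝ) ^ (-(2 * ψ)) < (2:ℝ) ^ (-1 : ℝ) :=
      Real.rpow_lt_rpow_of_exponent_lt (by norm_num) (by linarith)
    rw [Real.rpow_neg_one] at h2
    linarith
  set Kj : ℕ → ℕ := fun j => ⌊a * (j + 1 : ℝ)⌋₊ with hKj
  set H : ℕ → ℝ × Om m → ENNReal := fun j q => ((j + 1 : ℕ) : ENNReal) *
    ∑ i ∈ Finset.range (2 ^ (j + 1)), ∑ k ∈ Finset.Icc 1 (Kj j), Ret T' i k (b ^ j) q with hH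
  have hHm : ∀ j, Measurable (H j) := fun j =>
    (Finset.measurable_fun_sum _ fun i _ => Finset.measurable_fun_sum _ fun k _ =>
      Ret_measurable T' hT'm i k _).const_mul _
  have hHint : ∀ j, ∫⁻ q, H j q ∂(mLeb.prod P) ≤
      ENNReal.ofReal (8 * a * C * ((j + 1 : ℝ) ^ 2 * (2 * b ^ 2) ^ j)) := by
    intro j
    rw [hH]
    simp only
    rw [lintegral_const_mul _ (Finset.measurable_fun_sum _ fun i _ =>
      Finset.measurable_fun_sum _ fun k _ => Ret_measurable T' hT'm i k _),
      lintegral_finsetSum _ fun i _ =>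
      Finset.measurable_fun_sum _ fun k _ => Ret_measurable T' hT'm i k _]
    calc _ ≤ ((j + 1 : ℕ) : ENNReal) * ∑ i ∈ Finset.range (2 ^ (j + 1)),
          ∑ k ∈ Finset.Icc 1 (Kj j), ENNReal.ofReal (4 * C * (b ^ j) ^ 2) := by
          gcongr with i _
          rw [lintegral_finsetSum _ fun k _ => Ret_measurable T' hT'm i k _]
          refine Finset.sum_le_sum fun k hk => ?_
          exact Ret_int T' hT'm P C hnf' i k (Finset.mem_Icc.mp hk).1 _ (by positivity)
      _ = ENNReal.ofReal ((j + 1 : ℕ) * ((2 ^ (j + 1) : ℕ) * ((Kj j : ℕ) * (4 * C * (b ^ j) ^ 2)))) := by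
          rw [Finset.sum_const, Finset.sum_const, Finset.card_range, Nat.card_Icc,
            Nat.add_sub_cancel, nsmul_eq_mul, nsmul_eq_mul]
          generalize 4 * C * (b ^ j) ^ 2 = w
          rw [ENNReal.ofReal_mul (by positivity), ENNReal.ofReal_mul (by positivity),
            ENNReal.ofReal_mul (by positivity), ENNReal.ofReal_natCast, ENNReal.ofReal_natCast,
            ENNReal.ofReal_natCast]
      _ ≤ _ := by
          apply ENNReal.ofReal_le_ofReal
          have hK : (Kj j : ℝ) ≤ a * (j + 1) := Nat.floor_le (by positivity)
          calc _ ≤ ((j + 1 : ℕ) : ℝ) * ((2 ^ (j + 1) : ℕ) * ((a * (j + 1)) * (4 * C * (b ^ j) ^ 2))) := by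
                gcongr
            _ = _ := by push_cast; rw [mul_pow, ← pow_mul, ← pow_mul, pow_succ, mul_comm j 2]; ring
  have hsum : Summable fun j : ℕ => 8 * a * C * ((j + 1 : ℝ) ^ 2 * (2 * b ^ 2) ^ j) := by
    refine Summable.mul_left _ ?_
    have hρ : ‖2 * b ^ 2‖ < 1 := by rw [Real.norm_of_nonneg (by positivity)]; exact hb2
    have h0 := summable_pow_mul_geometric_of_norm_lt_one 2 hρ
    have h1 := summable_pow_mul_geometric_of_norm_lt_one 1 hρ
    have h2 := summable_pow_mul_geometric_of_norm_lt_one 0 hρ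
    refine ((h0.add (h1.mul_left 2)).add h2).congr fun j => ?_
    ring
  have hae : ∀ᵐ q ∂(mLeb.prod P), ∑' j, H j q < ⊤ := by
    refine ae_lt_top (Measurable.tsum hHm) ?_
    rw [lintegral_tsum fun j => (hHm j).aemeasurable]
    refine ne_top_of_le_ne_top ?_ (ENNReal.tsum_le_tsum hHint)
    rw [← ENNReal.ofReal_tsum_of_nonneg (fun j => by positivity) hsum]
    exact ENNReal.ofReal_ne_top
  filter_upwards [Measure.ae_ae_of_ae_prod hae] with x0 hx0
  filter_upwards [hx0] with ω hω
  have hfin : ∀ j, H j (x0, ω) ≠ ⊤ := fun j =>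
    ne_top_of_le_ne_top hω.ne (ENNReal.le_tsum j)
  have hlim : Tendsto (fun j => (H j (x0, ω)).toReal) atTop (𝓝 0) := by
    have := ENNReal.tendsto_atTop_zero_of_tsum_ne_top hω.ne
    have h2 := (ENNReal.tendsto_toReal ENNReal.zero_ne_top).comp this
    rw [ENNReal.toReal_zero] at h2
    exact h2
  have hlog : Tendsto (fun n : ℕ => Nat.log 2 n) atTop atTop := by
    refine tendsto_atTop.mpr fun B => ?_
    filter_upwards [eventually_ge_atTop (2 ^ B)] with n hn
    exact Nat.le_log_of_pow_le (by norm_num) hn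
  refine squeeze_zero' ?_ ?_ (hlim.comp hlog)
  · filter_upwards with n
    exact mul_nonneg (Real.log_natCast_nonneg n) (Finset.sum_nonneg fun i _ => ENNReal.toReal_nonneg)
  filter_upwards [eventually_ge_atTop 1] with n hn
  set j := Nat.log 2 n with hj
  have hn1 : 2 ^ j ≤ n := Nat.pow_log_le_self 2 (by omega)
  have hn2 : n < 2 ^ (j + 1) := Nat.lt_pow_succ_log_self (by norm_num) n
  have hnpos : (0:ℝ) < n := by exact_mod_cast hn
  have hlogn : Real.log n ≤ j + 1 := by
    have h1 : Real.log n ≤ Real.log ((2:ℝ) ^ (j + 1)) :=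
      Real.log_le_log hnpos (by exact_mod_cast hn2.le)
    rw [Real.log_pow] at h1
    have h2 : Real.log 2 ≤ 1 := by linarith [Real.log_two_lt_d9]
    push_cast at h1
    nlinarith
  have hr : (n : ℝ) ^ (-ψ) ≤ b ^ j := by
    have h1 : (n : ℝ) ^ (-ψ) ≤ ((2:ℝ) ^ j) ^ (-ψ) :=
      Real.rpow_le_rpow_of_nonpos (by positivity) (by exact_mod_cast hn1) (by linarith)
    refine h1.trans (le_of_eq ?_)
    rw [hb, ← Real.rpow_natCast, ← Real.rpow_natCast, ← Real.rpow_mul (by norm_num),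
      ← Real.rpow_mul (by norm_num), mul_comm]
  have hKle : ⌊a * Real.log n⌋₊ ≤ Kj j := Nat.floor_le_floor (by gcongr)
  have hterm : ∀ i, mLeb (Metric.ball x0 ((n : ℝ) ^ (-ψ)) ∩
      hitWithin T (shift^[i] ω) (Metric.ball x0 ((n : ℝ) ^ (-ψ))) ⌊a * Real.log n⌋₊) ≤
      ∑ k ∈ Finset.Icc 1 (Kj j), Ret T' i k (b ^ j) (x0, ω) := by
    intro i
    unfold Ret
    refine le_trans ?_ (measure_biUnion_finset_le _ _)
    unfold mLeb
    rw [Measure.restrict_apply' measurableSet_Icc, Measure.restrict_apply' measurableSet_Icc]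
    refine measure_mono ?_
    rintro x ⟨⟨hx, k, hk1, hk2, hk3⟩, hxI⟩
    refine ⟨?_, hxI⟩
    simp only [mem_iUnion]
    refine ⟨k, Finset.mem_Icc.mpr ⟨hk1, hk2.trans hKle⟩, ?_, ?_⟩
    · rw [Metric.mem_ball, Real.dist_eq] at hx
      exact hx.trans_le hr
    · rw [(hcomp (shift^[i] ω) k x hxI).2]
      rw [Metric.mem_ball, Real.dist_eq] at hk3
      exact hk3.trans_le hr
  have hle : ENNReal.ofReal (Real.log n) * ∑ i ∈ Finset.range n,
      mLeb (Metric.ball x0 ((n : ℝ) ^ (-ψ)) ∩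
      hitWithin T (shift^[i] ω) (Metric.ball x0 ((n : ℝ) ^ (-ψ))) ⌊a * Real.log n⌋₊) ≤
      H j (x0, ω) := by
    rw [hH]
    simp only
    refine mul_le_mul' ?_ ?_
    · rw [← ENNReal.ofReal_natCast]
      apply ENNReal.ofReal_le_ofReal
      push_cast; exact hlogn
    · refine (Finset.sum_le_sum fun i _ => hterm i).trans ?_
      exact Finset.sum_le_sum_of_subset (Finset.range_mono hn2.le)
  have := ENNReal.toReal_mono (hfin j) hle
  rw [ENNReal.toReal_mul, ENNReal.toReal_ofReal (Real.log_natCast_nonneg n),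
    ENNReal.toReal_sum fun i _ => measure_ne_top _ _] at this
  exact this
end
end
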